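/- Let 𝓡 = (R, <, …) be a densely linearly ordered structure and let X ⊆ R^n be a definable set of dimension d < n. Define 𝓖(X) to be the set of points x ∈ X such that there exist a coordinate projection π : R^n → R^d and an open box B containing x such that X ∩ B is the graph of a continuous map defined on π(B). Then 𝓖(X) is definable and constructible. Furthermore, dim(X \ 𝓖(X)) < d provided that: 𝓡 = (R, <, +, 0, …) is an expansion of a densely linearly ordered abelian group with 𝓡 ⊨ DC and 𝓡 ⊨ LUF₂; X is a D_Σ-set; and every D_Σ-set of dimension smaller than d is constructible. -/

import Mathlib

open FirstOrder Set Topology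

section CommonDefs

/-- A subset of `R^n` (coded as `Fin n → R`) is definable in the structure `𝓡` (with
universe `R` and language `L`) with parameters. -/
def IsDefinable (L : FirstOrder.Language) {R : Type*} [L.Structure R] {n : ℕ}
    (X : Set (Fin n → R)) : Prop :=
  Set.Definable (Set.univ : Set R) L X

/-- An open box in `R^n`: a product of `n` open intervals. -/
def OpenBox {R : Type*} [LT R] {n : ℕ} (B : Set (Fin n → R)) : Prop :=
  ∃ c d : Fin n → R, B = {x | ∀ i, c i < x i ∧ x i < d i}

/-- A closed box in `R^n`: a product of `n` closed intervals. -/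
def ClosedBox {R : Type*} [LE R] {n : ℕ} (B : Set (Fin n → R)) : Prop :=
  ∃ c d : Fin n → R, B = {x | ∀ i, c i ≤ x i ∧ x i ≤ d i}

/-- A subset of `R` which is a finite union of points and open intervals. -/
def FinUnionPtsIntervals {R : Type*} [Preorder R] (s : Set R) : Prop :=
  ∃ (P : Finset R) (Q : Finset (R × R)), s = ↑P ∪ ⋃ p ∈ Q, Set.Ioo p.1 p.2

/-- The fiber `X_x ⊆ R` of a set `X ⊆ R^{m+1}` over `x ∈ R^m`. -/
def fiber1 {R : Type*} {m : ℕ} (X : Set (Fin (m + 1) → R)) (x : Fin m → R) : Set R :=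
  {y | Fin.snoc x y ∈ X}

/-- The fiber `X_x ⊆ R^n` of a set `X ⊆ R^{m+n}` over `x ∈ R^m`. -/
def fiberN {R : Type*} {m n : ℕ} (X : Set (Fin (m + n) → R)) (x : Fin m → R) :
    Set (Fin n → R) :=
  {y | Fin.append x y ∈ X}

/-- The member `X_{r,s} ⊆ R^n` of a parameterized family coded by `F ⊆ R^{2+n}`. -/
def famFiber {R : Type*} {n : ℕ} (F : Set (Fin (2 + n) → R)) (r s : R) : Set (Fin n → R) :=
  {y | Fin.append ![r, s] y ∈ F}

/-- A bounded subset of `R^n`: contained in some closed box. -/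
def BddSet {R : Type*} [LE R] {n : ℕ} (X : Set (Fin n → R)) : Prop :=
  ∃ c d : R, ∀ y ∈ X, ∀ i, c ≤ y i ∧ y i ≤ d

/-- A discrete subset of a topological space: each of its points is isolated. -/
def DiscreteSet {α : Type*} [TopologicalSpace α] (S : Set α) : Prop :=
  ∀ y ∈ S, ∃ U : Set α, IsOpen U ∧ y ∈ U ∧ U ∩ S = {y}

/-- A locally finite subset: each point of the space has an open neighborhood meeting
the set in a finite set. -/
def LocFin {α : Type*} [TopologicalSpace α] (S : Set α) : Prop :=
  ∀ x : α, ∃ U : Set α, IsOpen U ∧ x ∈ U ∧ (S ∩ U).Finite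

/-- `F ⊆ R^{2+n}` codes a `D_Σ`-family `{X_{r,s}}_{r>0,s>0}` of CBD subsets of `R^n`:
each fiber is closed, bounded and definable, the family is increasing in `r` and
decreasing in `s`. -/
def IsDSigmaFamily (L : FirstOrder.Language) {R : Type*} [L.Structure R] [LinearOrder R]
    [Zero R] [TopologicalSpace R] {n : ℕ} (F : Set (Fin (2 + n) → R)) : Prop :=
  IsDefinable L F ∧
    (∀ r s : R, 0 < r → 0 < s →
      IsDefinable L (famFiber F r s) ∧ IsClosed (famFiber F r s) ∧ BddSet (famFiber F r s)) ∧
    (∀ r r' s : R, 0 < r → 0 < s → r ≤ r' → famFiber F r s ⊆ famFiber F r' s) ∧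
    (∀ r s s' : R, 0 < r → 0 < s → s ≤ s' → famFiber F r s' ⊆ famFiber F r s)

/-- A `D_Σ`-set: the union `⋃_{r>0,s>0} X_{r,s}` of a `D_Σ`-family. -/
def IsDSigma (L : FirstOrder.Language) {R : Type*} [L.Structure R] [LinearOrder R]
    [Zero R] [TopologicalSpace R] {n : ℕ} (X : Set (Fin n → R)) : Prop :=
  ∃ F : Set (Fin (2 + n) → R), IsDSigmaFamily L F ∧
    X = ⋃ (r : R) (_ : 0 < r) (s : R) (_ : 0 < s), famFiber F r s

/-- Constructible sets: finite boolean combinations of open sets. -/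
inductive IsConstructibleSet {α : Type*} [TopologicalSpace α] : Set α → Prop
  | of_isOpen (s : Set α) : IsOpen s → IsConstructibleSet s
  | compl (s : Set α) : IsConstructibleSet s → IsConstructibleSet sᶜ
  | union (s t : Set α) : IsConstructibleSet s → IsConstructibleSet t →
      IsConstructibleSet (s ∪ t)

/-- `𝓡 ⊨ DC`: every nonempty definable subset of `R` bounded above has a supremum. -/
def DCProp (L : FirstOrder.Language) (R : Type*) [L.Structure R] [Preorder R] : Prop :=
  ∀ s : Set R, IsDefinable L {v : Fin 1 → R | v 0 ∈ s} → s.Nonempty → BddAbove s →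
    ∃ a : R, IsLUB s a

/-- `𝓡 ⊨ LUF₂` (locally uniform finiteness of the second kind). -/
def LUF2 (L : FirstOrder.Language) (R : Type*) [L.Structure R] [LinearOrder R]
    [TopologicalSpace R] : Prop :=
  ∀ (m : ℕ) (X : Set (Fin (m + 1) → R)), IsDefinable L X → ∀ (a : R) (b : Fin m → R),
    ∃ N : ℕ, 0 < N ∧ ∃ p q : R, a ∈ interior (Set.Icc p q) ∧
      ∃ U : Set (Fin m → R), OpenBox U ∧ b ∈ U ∧
        ∀ x ∈ U, ∀ p' q' : R, a ∈ interior (Set.Icc p' q') → Set.Icc p' q' ⊆ Set.Icc p q →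
          (fiber1 X x ∩ Set.Icc p' q').Infinite ∨ (fiber1 X x ∩ Set.Icc p' q').ncard ≤ N

/-- `𝓡 ⊨ LUF₁`: `LUF₂` with `U` always taken to be all of `R^m`. -/
def LUF1 (L : FirstOrder.Language) (R : Type*) [L.Structure R] [LinearOrder R]
    [TopologicalSpace R] : Prop :=
  ∀ (m : ℕ) (X : Set (Fin (m + 1) → R)), IsDefinable L X → ∀ a : R,
    ∃ N : ℕ, 0 < N ∧ ∃ p q : R, a ∈ interior (Set.Icc p q) ∧
      ∀ (x : Fin m → R), ∀ p' q' : R,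
        a ∈ interior (Set.Icc p' q') → Set.Icc p' q' ⊆ Set.Icc p q →
          (fiber1 X x ∩ Set.Icc p' q').Infinite ∨ (fiber1 X x ∩ Set.Icc p' q').ncard ≤ N

/-- `𝓡 ⊨ SLUF`: `LUF₁` with the interval `I` chosen independently of the definable set. -/
def SLUF (L : FirstOrder.Language) (R : Type*) [L.Structure R] [LinearOrder R]
    [TopologicalSpace R] : Prop :=
  ∀ a : R, ∃ p q : R, a ∈ interior (Set.Icc p q) ∧
    ∀ (m : ℕ) (X : Set (Fin (m + 1) → R)), IsDefinable L X →
      ∃ N : ℕ, 0 < N ∧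
        ∀ (x : Fin m → R), ∀ p' q' : R,
          a ∈ interior (Set.Icc p' q') → Set.Icc p' q' ⊆ Set.Icc p q →
            (fiber1 X x ∩ Set.Icc p' q').Infinite ∨ (fiber1 X x ∩ Set.Icc p' q').ncard ≤ N

/-- The language of the open core of `𝓡`: one `n`-ary relation symbol for each
`𝓡`-definable open subset of `R^n`. -/
def openCoreLang (L : FirstOrder.Language) (R : Type*) [L.Structure R] [TopologicalSpace R] :
    FirstOrder.Language where
  Functions := fun _ => Empty
  Relations := fun n => { s : Set (Fin n → R) // Set.Definable (Set.univ : Set R) L s ∧ IsOpen s }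

/-- The open core of `𝓡`: the structure on `R` interpreting each relation symbol by the
corresponding `𝓡`-definable open set. -/
def openCoreStructure (L : FirstOrder.Language) (R : Type*) [L.Structure R]
    [TopologicalSpace R] : (openCoreLang L R).Structure R where
  funMap := fun f _ => f.elim
  RelMap := fun s x => x ∈ s.1

/-- A set is definable in the open core of `𝓡` if it is definable (with parameters) in the
structure generated by the `𝓡`-definable open sets. -/
def DefinableInOpenCore (L : FirstOrder.Language) (R : Type*) [L.Structure R]
    [TopologicalSpace R] {n : ℕ} (X : Set (Fin n → R)) : Prop :=
  letI := openCoreStructure L R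
  Set.Definable (Set.univ : Set R) (openCoreLang L R) X

/-- The local dimension `dim_x X` of `X ⊆ R^n` at `x`, an element of `{-∞} ∪ ℕ ∪ {∞}`:
the supremum of the nonnegative integers `d` such that for every open box `B` containing
`x`, some coordinate projection of `B ∩ X` to `R^d` has nonempty interior (and `-∞` if
some open box containing `x` misses `X`). -/
noncomputable def locDim {R : Type*} [LT R] [TopologicalSpace R] {n : ℕ}
    (X : Set (Fin n → R)) (x : Fin n → R) : WithBot ℕ∞ :=
  sSup {e : WithBot ℕ∞ | ∃ d : ℕ, e = ((d : ℕ∞) : WithBot ℕ∞) ∧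
    ∀ B : Set (Fin n → R), OpenBox B → x ∈ B →
      ∃ f : Fin d → Fin n, Function.Injective f ∧
        (interior ((fun y => y ∘ f) '' (B ∩ X))).Nonempty}

/-- The dimension of `X ⊆ R^n`: the supremum of the local dimensions. -/
noncomputable def setDim {R : Type*} [LT R] [TopologicalSpace R] {n : ℕ}
    (X : Set (Fin n → R)) : WithBot ℕ∞ :=
  ⨆ x : Fin n → R, locDim X x

/-- The projective dimension of `X ⊆ R^n`: the supremum of the nonnegative integers `d`
such that some coordinate projection of `X` to `R^d` has nonempty interior (`-∞` for the
empty set). -/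
noncomputable def projDim {R : Type*} [TopologicalSpace R] {n : ℕ}
    (X : Set (Fin n → R)) : WithBot ℕ∞ :=
  sSup {e : WithBot ℕ∞ | ∃ d : ℕ, e = ((d : ℕ∞) : WithBot ℕ∞) ∧
    ∃ f : Fin d → Fin n, Function.Injective f ∧
      (interior ((fun y => y ∘ f) '' X)).Nonempty}

/-- A subset of `R` which is a union of at most `N` open intervals. -/
def UnionAtMostOpenIntervals {R : Type*} [Preorder R] (N : ℕ) (s : Set R) : Prop :=
  ∃ Q : Finset (R × R), Q.card ≤ N ∧ s = ⋃ p ∈ Q, Set.Ioo p.1 p.2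

/-- A subset of `R` which is a union of at most `N₁` points and `N₂` closed intervals. -/
def UnionAtMostPtsClosedIntervals {R : Type*} [Preorder R] (N₁ N₂ : ℕ) (s : Set R) : Prop :=
  ∃ (P : Finset R) (Q : Finset (R × R)), P.card ≤ N₁ ∧ Q.card ≤ N₂ ∧
    s = ↑P ∪ ⋃ p ∈ Q, Set.Icc p.1 p.2

/-- A subset of `R` which is a union of at most `N₁` points and `N₂` open intervals. -/
def UnionAtMostPtsOpenIntervals {R : Type*} [Preorder R] (N₁ N₂ : ℕ) (s : Set R) : Prop :=
  ∃ (P : Finset R) (Q : Finset (R × R)), P.card ≤ N₁ ∧ Q.card ≤ N₂ ∧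
    s = ↑P ∪ ⋃ p ∈ Q, Set.Ioo p.1 p.2

/-- `X ∩ B` is the graph of a continuous map defined on the coordinate-projection image
of `B` (the projection being given by the injection `f` of coordinates). -/
def IsGraphOn {R : Type*} [TopologicalSpace R] {n d : ℕ} (f : Fin d → Fin n)
    (S : Set (Fin n → R)) (D : Set (Fin d → R)) : Prop :=
  ∃ g : (Fin d → R) → (Fin n → R), ContinuousOn g D ∧ (∀ z ∈ D, (g z) ∘ f = z) ∧ S = g '' D

end CommonDefs

/-- The set `𝓖(X)` of points of `X` near which `X` is the graph of a continuous map over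
some coordinate subspace `R^d`. -/
def goodPoints {R : Type*} [LT R] [TopologicalSpace R] {n : ℕ} (d : ℕ)
    (X : Set (Fin n → R)) : Set (Fin n → R) :=
  {x | x ∈ X ∧ ∃ f : Fin d → Fin n, Function.Injective f ∧
    ∃ B : Set (Fin n → R), OpenBox B ∧ x ∈ B ∧
      IsGraphOn f (X ∩ B) ((fun y => y ∘ f) '' B)}

section Helpers

open FirstOrder Set Topology
set_option linter.unusedVariables false
set_option linter.unusedSectionVars false

section DfnSec

variable (L : FirstOrder.Language) {R : Type*} [L.Structure R] {ι κ : Type}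

/-- Definable predicates. -/
def Dfn (P : (ι → R) → Prop) : Prop := Set.Definable (Set.univ : Set R) L {v | P v}

/-- Definable functions. -/
def DFn (t : (ι → R) → R) : Prop := Set.DefinableFun L (Set.univ : Set R) t

variable {L} {P Q : (ι → R) → Prop}

theorem Dfn.congr (h : Dfn L P) (hPQ : ∀ v, P v ↔ Q v) : Dfn L Q := by
  have : P = Q := funext fun v => propext (hPQ v)
  exact this ▸ h

theorem Dfn.and (hP : Dfn L P) (hQ : Dfn L Q) : Dfn L (fun v => P v ∧ Q v) :=
  Set.Definable.inter hP hQ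

theorem Dfn.or (hP : Dfn L P) (hQ : Dfn L Q) : Dfn L (fun v => P v ∨ Q v) :=
  Set.Definable.union hP hQ

theorem Dfn.not (hP : Dfn L P) : Dfn L (fun v => ¬ P v) :=
  Set.Definable.compl hP

theorem Dfn.imp (hP : Dfn L P) (hQ : Dfn L Q) : Dfn L (fun v => P v → Q v) :=
  (hP.not.or hQ).congr fun v => by tauto

theorem Dfn.finAll {α : Type*} [Finite α] {P : α → (ι → R) → Prop} (h : ∀ a, Dfn L (P a)) :
    Dfn L (fun v => ∀ a, P a v) := by
  have := Set.definable_iInter_of_finite (f := fun a => {v | P a v}) h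
  unfold Dfn
  convert this using 1
  ext v
  simp

theorem Dfn.finEx {α : Type*} [Finite α] {P : α → (ι → R) → Prop} (h : ∀ a, Dfn L (P a)) :
    Dfn L (fun v => ∃ a, P a v) := by
  have := Set.definable_iUnion_of_finite (f := fun a => {v | P a v}) h
  unfold Dfn
  convert this using 1
  ext v
  simp

theorem Dfn.triv {p : Prop} : Dfn L (fun _ : ι → R => p) := by
  by_cases hp : p
  · have := Set.definable_univ (A := (Set.univ : Set R)) (L := L) (α := ι)
    unfold Dfn
    convert this using 1
    ext; simp [hp]
  · have := Set.definable_empty (A := (Set.univ : Set R)) (L := L) (α := ι)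
    unfold Dfn
    convert this using 1
    ext; simp [hp]

theorem Dfn.exs [Finite κ] {P : (ι → R) → (κ → R) → Prop}
    (h : Dfn L (fun w : ι ⊕ κ → R => P (fun i => w (Sum.inl i)) (fun k => w (Sum.inr k)))) :
    Dfn L (fun v => ∃ u : κ → R, P v u) :=
  Set.Definable.exists_of_finite h

theorem Dfn.alls [Finite κ] {P : (ι → R) → (κ → R) → Prop}
    (h : Dfn L (fun w : ι ⊕ κ → R => P (fun i => w (Sum.inl i)) (fun k => w (Sum.inr k)))) :
    Dfn L (fun v => ∀ u : κ → R, P v u) :=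
  Set.Definable.forall_of_finite h

theorem Dfn.subst [Finite κ] {Q : (κ → R) → Prop} {t : (ι → R) → κ → R} (h : Dfn L Q)
    (ht : ∀ k, DFn L (fun v => t v k)) : Dfn L (fun v => Q (t v)) :=
  Set.Definable.preimage_map (F := t) ht h

theorem DFn.var (i : ι) : DFn L (fun v : ι → R => v i) := Set.DefinableFun.proj L

theorem DFn.const (c : R) : DFn L (fun _ : ι → R => c) :=
  FirstOrder.Language.definableFun_const L ι (Set.mem_univ c)

theorem Dfn.eq {s t : (ι → R) → R} (hs : DFn L s) (ht : DFn L t) : Dfn L (fun v => s v = t v) :=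
  Set.DefinableFun.ofPred_eq hs ht

theorem Dfn.ex {P : (ι → R) → R → Prop}
    (h : Dfn L (fun w : ι ⊕ Unit → R => P (fun i => w (Sum.inl i)) (w (Sum.inr ())))) :
    Dfn L (fun v => ∃ u : R, P v u) := by
  refine (Dfn.exs (κ := Unit) (P := fun v u => P v (u ())) h).congr fun v => ?_
  exact ⟨fun ⟨u, hu⟩ => ⟨u (), hu⟩, fun ⟨u, hu⟩ => ⟨fun _ => u, hu⟩⟩

theorem Dfn.all {P : (ι → R) → R → Prop}
    (h : Dfn L (fun w : ι ⊕ Unit → R => P (fun i => w (Sum.inl i)) (w (Sum.inr ())))) :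
    Dfn L (fun v => ∀ u : R, P v u) := by
  refine (Dfn.alls (κ := Unit) (P := fun v u => P v (u ())) h).congr fun v => ?_
  exact ⟨fun h u => h (fun _ => u), fun h u => h (u ())⟩

/-- The order is definable. -/
class DLt (L : FirstOrder.Language) (R : Type*) [L.Structure R] [LT R] : Prop where
  lt_def : IsDefinable L {v : Fin 2 → R | v 0 < v 1}

theorem Dfn.lt [LinearOrder R] [DLt L R] {s t : (ι → R) → R} (hs : DFn L s) (ht : DFn L t) :
    Dfn L (fun v => s v < t v) := by
  have h : Dfn L (fun v : Fin 2 → R => v 0 < v 1) := DLt.lt_def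
  refine Dfn.subst (t := fun v => ![s v, t v]) h fun k => ?_
  fin_cases k
  · exact hs
  · exact ht

theorem Dfn.le [LinearOrder R] [DLt L R] {s t : (ι → R) → R} (hs : DFn L s) (ht : DFn L t) :
    Dfn L (fun v => s v ≤ t v) :=
  (Dfn.lt ht hs).not.congr fun v => not_lt

/-- Addition is definable. -/
class DAdd (L : FirstOrder.Language) (R : Type*) [L.Structure R] [Add R] : Prop where
  add_def : IsDefinable L {v : Fin 3 → R | v 0 + v 1 = v 2}

theorem DFn.of_graph {t : (ι → R) → R}
    (h : Dfn L (fun w : Option ι → R => t (fun i => w (some i)) = w none)) : DFn L t := h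

theorem DFn.comp_some {t : (ι → R) → R} (h : DFn L t) :
    DFn L (fun w : Option ι → R => t (fun i => w (some i))) := by
  have h' : Dfn L (fun w : Option ι → R => t (fun i => w (some i)) = w none) := h
  refine DFn.of_graph ?_
  exact h'.preimage_comp (fun i : Option ι => match i with | none => none | some j => some (some j))

theorem DFn.add [AddCommGroup R] [DAdd L R] {s t : (ι → R) → R} (hs : DFn L s) (ht : DFn L t) :
    DFn L (fun v => s v + t v) := by
  have h : Dfn L (fun v : Fin 3 → R => v 0 + v 1 = v 2) := DAdd.add_def
  refine DFn.of_graph ?_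
  refine Dfn.subst (t := fun w : Option ι → R =>
    ![s (fun i => w (some i)), t (fun i => w (some i)), w none]) h fun k => ?_
  fin_cases k
  · exact hs.comp_some
  · exact ht.comp_some
  · exact DFn.var none

theorem DFn.neg [AddCommGroup R] [DAdd L R] {s : (ι → R) → R} (hs : DFn L s) :
    DFn L (fun v => - s v) := by
  refine DFn.of_graph ?_
  refine (Dfn.eq (hs.comp_some.add (DFn.var none)) (DFn.const 0)).congr fun v => ?_
  constructor
  · intro h; exact neg_eq_of_add_eq_zero_right h
  · intro h; rw [← h]; simp

theorem DFn.sub [AddCommGroup R] [DAdd L R] {s t : (ι → R) → R} (hs : DFn L s) (ht : DFn L t) :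
    DFn L (fun v => s v - t v) := by
  simp only [sub_eq_add_neg]
  exact hs.add ht.neg

theorem Dfn.absLt [AddCommGroup R] [LinearOrder R] [IsOrderedAddMonoid R] [DAdd L R] [DLt L R]
    {s u : (ι → R) → R} (hs : DFn L s) (hu : DFn L u) :
    Dfn L (fun v => |s v| < u v) :=
  ((Dfn.lt hu.neg hs).and (Dfn.lt hs hu)).congr fun v => abs_lt.symm

theorem Dfn.absLe [AddCommGroup R] [LinearOrder R] [IsOrderedAddMonoid R] [DAdd L R] [DLt L R]
    {s u : (ι → R) → R} (hs : DFn L s) (hu : DFn L u) :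
    Dfn L (fun v => |s v| ≤ u v) :=
  ((Dfn.le hu.neg hs).and (Dfn.le hs hu)).congr fun v => abs_le.symm

theorem Dfn.leAbs [AddCommGroup R] [LinearOrder R] [IsOrderedAddMonoid R] [DAdd L R] [DLt L R]
    {s u : (ι → R) → R} (hs : DFn L s) (hu : DFn L u) :
    Dfn L (fun v => u v ≤ |s v|) :=
  (Dfn.absLt hs hu).not.congr fun v => not_lt

theorem dfn_iff {n : ℕ} {X : Set (Fin n → R)} : IsDefinable L X ↔ Dfn L (fun v => v ∈ X) := Iff.rfl

theorem Dfn.reindex {Q : (κ → R) → Prop} (h : Dfn L Q) (g : κ → ι) :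
    Dfn L (fun v : ι → R => Q (fun k => v (g k))) :=
  Set.Definable.preimage_comp g h

end DfnSec

attribute [irreducible] Dfn DFn

section PartOne

variable {R : Type*} [LinearOrder R] [TopologicalSpace R] [OrderTopology R]

/-- Box membership. -/
def InBox {ι : Type} (c e x : ι → R) : Prop := ∀ i, c i < x i ∧ x i < e i

theorem isOpen_inBox {ι : Type} [Finite ι] (c e : ι → R) : IsOpen {x | InBox c e x} := by
  have : {x : ι → R | InBox c e x} = ⋂ i, {x | c i < x i ∧ x i < e i} := by
    ext x; simp [InBox]
  rw [this]
  refine isOpen_iInter_of_finite fun i => ?_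
  exact (isOpen_Ioo (a := c i) (b := e i)).preimage (continuous_apply (A := fun _ : ι => R) i)

theorem exists_inBox_subset [NoMinOrder R] [NoMaxOrder R] {ι : Type} [Finite ι] {O : Set (ι → R)}
    (hO : IsOpen O) {x : ι → R} (hx : x ∈ O) :
    ∃ c e : ι → R, InBox c e x ∧ ∀ y, InBox c e y → y ∈ O := by
  obtain ⟨u, hu, hsub⟩ := isOpen_pi_iff'.1 hO x hx
  have : ∀ i, ∃ l r, x i ∈ Set.Ioo l r ∧ Set.Ioo l r ⊆ u i := fun i =>
    mem_nhds_iff_exists_Ioo_subset.1 ((hu i).1.mem_nhds (hu i).2)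
  choose c e h1 h2 using this
  refine ⟨c, e, fun i => h1 i, fun y hy => hsub fun i _ => h2 i (hy i)⟩

/-- First-order version of the graph condition. -/
def GoodBox {n d : ℕ} (f : Fin d → Fin n) (X : Set (Fin n → R)) (c e : Fin n → R) : Prop :=
  (∀ y0 : Fin n → R, InBox c e y0 → ∃ y : Fin n → R, y ∈ X ∧ InBox c e y ∧ ∀ j, y (f j) = y0 (f j)) ∧
  (∀ y y' : Fin n → R, y ∈ X → InBox c e y → y' ∈ X → InBox c e y' →
    (∀ j, y (f j) = y' (f j)) → ∀ i, y i = y' i) ∧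
  (∀ y : Fin n → R, y ∈ X → InBox c e y → ∀ p q : Fin n → R, InBox p q y →
    ∃ p' q' : Fin d → R, InBox p' q' (fun j => y (f j)) ∧
      ∀ y' : Fin n → R, y' ∈ X → InBox c e y' → InBox p' q' (fun j => y' (f j)) → InBox p q y')

theorem isGraphOn_iff [NoMinOrder R] [NoMaxOrder R] {n d : ℕ} (f : Fin d → Fin n)
    (X : Set (Fin n → R)) (c e : Fin n → R) :
    IsGraphOn f (X ∩ {x | InBox c e x}) ((fun y => y ∘ f) '' {x | InBox c e x}) ↔
      GoodBox f X c e := by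
  constructor
  · rintro ⟨g, hc, hg, hS⟩
    have key : ∀ y, y ∈ X → InBox c e y → g (y ∘ f) = y := by
      intro y hy hb
      have : y ∈ X ∩ {x | InBox c e x} := ⟨hy, hb⟩
      rw [hS] at this
      obtain ⟨z, hz, rfl⟩ := this
      rw [hg z hz]
    refine ⟨?_, ?_, ?_⟩
    · intro y0 h0
      have hz : y0 ∘ f ∈ (fun y => y ∘ f) '' {x : Fin n → R | InBox c e x} := ⟨y0, h0, rfl⟩
      have : g (y0 ∘ f) ∈ X ∩ {x | InBox c e x} := by rw [hS]; exact ⟨_, hz, rfl⟩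
      exact ⟨_, this.1, this.2, fun j => congrFun (hg _ hz) j⟩
    · intro y y' h1 h2 h3 h4 h5
      have : y ∘ f = y' ∘ f := funext h5
      have h6 := key y h1 h2
      rw [this, key y' h3 h4] at h6
      intro i; rw [h6]
    · intro y hy hb p q hpq
      have hz : y ∘ f ∈ (fun y => y ∘ f) '' {x : Fin n → R | InBox c e x} := ⟨y, hb, rfl⟩
      have h1 := hc _ hz
      have h2 : {x | InBox p q x} ∈ 𝓝 (g (y ∘ f)) :=
        (isOpen_inBox p q).mem_nhds (by rw [key y hy hb]; exact hpq)
      have h3 := h1 h2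
      rw [Filter.mem_map, mem_nhdsWithin] at h3
      obtain ⟨u, huo, hyu, hu⟩ := h3
      obtain ⟨p', q', h4, h5⟩ := exists_inBox_subset huo hyu
      refine ⟨p', q', h4, fun y' hy' hb' h6 => ?_⟩
      have h7 : y' ∘ f ∈ u ∩ (fun y => y ∘ f) '' {x : Fin n → R | InBox c e x} :=
        ⟨h5 _ h6, ⟨y', hb', rfl⟩⟩
      have h8 : InBox p q (g (y' ∘ f)) := hu h7
      rwa [key y' hy' hb'] at h8
  · rintro ⟨h1, h2, h3⟩
    classical
    have hex : ∀ z : Fin d → R, ∃ y : Fin n → R,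
        z ∈ (fun y => y ∘ f) '' {x : Fin n → R | InBox c e x} → y ∈ X ∧ InBox c e y ∧ y ∘ f = z := by
      intro z
      by_cases hz : z ∈ (fun y => y ∘ f) '' {x : Fin n → R | InBox c e x}
      · obtain ⟨y0, h0, rfl⟩ := hz
        obtain ⟨y, ha, hb, hc⟩ := h1 y0 h0
        exact ⟨y, fun _ => ⟨ha, hb, funext hc⟩⟩
      · exact ⟨c, fun h => absurd h hz⟩
    choose g hg using hex
    have hS : ∀ y, y ∈ X → InBox c e y → g (y ∘ f) = y := by
      intro y hy hb
      obtain ⟨ha, hb', hc⟩ := hg (y ∘ f) ⟨y, hb, rfl⟩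
      exact funext (h2 _ _ ha hb' hy hb fun j => congrFun hc j)
    refine ⟨g, ?_, fun z hz => (hg z hz).2.2, ?_⟩
    · intro z hz
      rw [ContinuousWithinAt, Filter.tendsto_def]
      intro s hs
      obtain ⟨s', hs', ho, hzs⟩ := mem_nhds_iff.1 hs
      obtain ⟨p, q, hpq, hsub⟩ := exists_inBox_subset ho hzs
      obtain ⟨ha, hb, hc⟩ := hg z hz
      obtain ⟨p', q', h4, h5⟩ := h3 _ ha hb p q hpq
      rw [mem_nhdsWithin]
      refine ⟨_, isOpen_inBox p' q', ?_, ?_⟩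
      · have : (fun j => g z (f j)) = z := hc
        rw [this] at h4; exact h4
      · rintro w ⟨hw, hwD⟩
        obtain ⟨ha', hb', hc'⟩ := hg w hwD
        refine hs' (hsub _ (h5 _ ha' hb' ?_))
        have : (fun j => g w (f j)) = w := hc'
        rw [this]; exact hw
    · ext y
      constructor
      · rintro ⟨hy, hb⟩
        exact ⟨y ∘ f, ⟨y, hb, rfl⟩, hS y hy hb⟩
      · rintro ⟨z, hz, rfl⟩
        exact ⟨(hg z hz).1, (hg z hz).2.1⟩

theorem mem_goodPoints_iff [NoMinOrder R] [NoMaxOrder R] {n d : ℕ} (X : Set (Fin n → R))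
    (x : Fin n → R) : x ∈ goodPoints d X ↔
    x ∈ X ∧ ∃ f : Fin d → Fin n, Function.Injective f ∧
      ∃ c e : Fin n → R, InBox c e x ∧ GoodBox f X c e := by
  constructor
  · rintro ⟨hx, f, hf, B, ⟨c, e, rfl⟩, hxB, hG⟩
    exact ⟨hx, f, hf, c, e, hxB, (isGraphOn_iff f X c e).1 hG⟩
  · rintro ⟨hx, f, hf, c, e, hxB, hG⟩
    exact ⟨hx, f, hf, _, ⟨c, e, rfl⟩, hxB, (isGraphOn_iff f X c e).2 hG⟩

theorem Dfn.inBox {L : FirstOrder.Language} [L.Structure R] [DLt L R] {ι κ : Type} [Finite κ]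
    {c e x : (ι → R) → κ → R} (hc : ∀ k, DFn L (fun v => c v k)) (he : ∀ k, DFn L (fun v => e v k))
    (hx : ∀ k, DFn L (fun v => x v k)) : Dfn L (fun v => InBox (c v) (e v) (x v)) := by
  unfold InBox
  exact Dfn.finAll fun k => (Dfn.lt (hc k) (hx k)).and (Dfn.lt (hx k) (he k))

theorem goodPoints_definable {L : FirstOrder.Language} [L.Structure R] [DLt L R]
    [NoMinOrder R] [NoMaxOrder R] {n d : ℕ} (X : Set (Fin n → R)) (hX : IsDefinable L X) :
    IsDefinable L (goodPoints d X) := by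
  have hX' : Dfn L (fun v => v ∈ X) := dfn_iff.1 hX
  have hmem : ∀ {ι : Type} {t : (ι → R) → Fin n → R}, (∀ k, DFn L (fun v => t v k)) →
    Dfn L (fun v => t v ∈ X) := fun ht => Dfn.subst hX' ht
  have : Dfn L (fun x => x ∈ goodPoints d X) := by
    simp only [mem_goodPoints_iff]
    refine hX'.and (Dfn.finEx fun f => Dfn.triv.and (Dfn.exs (Dfn.exs ?_)))
    unfold GoodBox
    repeat' first
      | with_reducible apply Dfn.and
      | with_reducible apply Dfn.inBox
      | with_reducible apply hmem
      | with_reducible apply Dfn.imp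
      | with_reducible apply Dfn.exs
      | with_reducible apply Dfn.alls
      | with_reducible apply Dfn.finAll
      | with_reducible apply Dfn.eq
      | with_reducible apply DFn.var
      | intro k
  exact dfn_iff.2 this

theorem goodPoints_constructible [NoMinOrder R] [NoMaxOrder R] {n d : ℕ} (X : Set (Fin n → R)) :
    IsConstructibleSet (goodPoints d X) := by
  let U : Set (Fin n → R) := {x | ∃ f : Fin d → Fin n, Function.Injective f ∧
      ∃ c e : Fin n → R, InBox c e x ∧ GoodBox f X c e}
  have hU : IsOpen U := by
    rw [isOpen_iff_forall_mem_open]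
    rintro x ⟨f, hf, c, e, hx, hG⟩
    exact ⟨_, fun y hy => ⟨f, hf, c, e, hy, hG⟩, isOpen_inBox c e, hx⟩
  have hUG : IsOpen (U \ X) := by
    rw [isOpen_iff_forall_mem_open]
    rintro x ⟨⟨f, hf, c, e, hx, hG⟩, hxX⟩
    obtain ⟨y, hy, hyB, hyx⟩ := hG.1 x hx
    have hne : y ≠ x := fun h => hxX (h ▸ hy)
    obtain ⟨V, W, hV, hW, hyV, hxW, hVW⟩ := t2_separation hne
    obtain ⟨p, q, hpq, hsub⟩ := exists_inBox_subset hV hyV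
    obtain ⟨p', q', h4, h5⟩ := hG.2.2 y hy hyB p q hpq
    refine ⟨{w | InBox c e w} ∩ W ∩ {w | InBox p' q' (fun j => w (f j))}, ?_, ?_, ?_⟩
    · rintro w ⟨⟨hw1, hw2⟩, hw3⟩
      refine ⟨⟨f, hf, c, e, hw1, hG⟩, fun hwX => ?_⟩
      exact Set.disjoint_left.1 hVW (hsub _ (h5 w hwX hw1 hw3)) hw2
    · refine ((isOpen_inBox c e).inter hW).inter ((isOpen_inBox p' q').preimage ?_)
      fun_prop
    · refine ⟨⟨hx, hxW⟩, ?_⟩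
      have : (fun j => x (f j)) = fun j => y (f j) := funext fun j => (hyx j).symm
      show InBox p' q' (fun j => x (f j))
      rw [this]; exact h4
  have : goodPoints d X = (Uᶜ ∪ (U \ X))ᶜ := by
    ext x
    rw [mem_goodPoints_iff]
    simp only [mem_compl_iff, mem_union, mem_sdiff, not_or, not_not, not_and]
    exact ⟨fun ⟨h1, h2⟩ => ⟨h2, fun _ => h1⟩, fun ⟨h1, h2⟩ => ⟨h2 h1, h1⟩⟩
  rw [this]
  exact .compl _ (.union _ _ (.compl _ (.of_isOpen _ hU)) (.of_isOpen _ hUG))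

theorem exists_lt_gt_of_setDim {n d : ℕ} (hdn : d < n) (X : Set (Fin n → R))
    (hdim : setDim X = ((d : ℕ∞) : WithBot ℕ∞)) (a : R) : (∃ b, b < a) ∧ (∃ b, a < b) := by
  have h : locDim X (fun _ => a) ≤ ((d : ℕ∞) : WithBot ℕ∞) := by
    rw [← hdim]; exact le_iSup (fun x => locDim X x) _
  have h2 : ∃ B : Set (Fin n → R), OpenBox B ∧ (fun _ => a) ∈ B := by
    by_contra hne
    push Not at hne
    have : (((d + 1 : ℕ) : ℕ∞) : WithBot ℕ∞) ≤ locDim X (fun _ => a) :=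
      le_sSup ⟨d + 1, rfl, fun B hB hx => absurd hx (hne B hB)⟩
    have h3 := this.trans h
    norm_cast at h3
    omega
  obtain ⟨B, ⟨c, e, rfl⟩, hB⟩ := h2
  have := hB ⟨0, by omega⟩
  exact ⟨⟨_, this.1⟩, ⟨_, this.2⟩⟩

end PartOne

/-- The standing assumptions on the structure. -/
class GS (L : FirstOrder.Language) (R : Type*) [L.Structure R] [AddCommGroup R] [LinearOrder R]
    [TopologicalSpace R] : Prop extends DLt L R, DAdd L R where
  dc : DCProp L R
  luf : LUF2 L R

section Basic

variable {L : FirstOrder.Language} {R : Type*} [L.Structure R] [AddCommGroup R] [LinearOrder R]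
  [IsOrderedAddMonoid R] [DenselyOrdered R] [Nontrivial R] [TopologicalSpace R] [OrderTopology R]

/-- Nearness in the sup norm. -/
def Nr {ι : Type} (δ : R) (x y : ι → R) : Prop := ∀ i, |y i - x i| < δ

theorem Nr.mono {ι : Type} {δ δ' : R} (h : δ ≤ δ') {x y : ι → R} (hn : Nr δ x y) : Nr δ' x y :=
  fun i => (hn i).trans_le h

theorem Nr.refl {ι : Type} {δ : R} (h : 0 < δ) (x : ι → R) : Nr δ x x := fun i => by simpa using h

theorem Nr.symm {ι : Type} {δ : R} {x y : ι → R} (h : Nr δ x y) : Nr δ y x := fun i => by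
  rw [abs_sub_comm]; exact h i

theorem Nr.trans {ι : Type} {δ δ' : R} {x y z : ι → R} (h : Nr δ x y) (h' : Nr δ' y z) :
    Nr (δ + δ') x z := fun i => by
  have h1 := h i
  have h2 := h' i
  have : z i - x i = (y i - x i) + (z i - y i) := by abel
  rw [this]
  exact (abs_add_le _ _).trans_lt (add_lt_add h1 h2)

theorem isOpen_nr {ι : Type} [Finite ι] (δ : R) (x : ι → R) : IsOpen {y | Nr δ x y} := by
  have : {y : ι → R | Nr δ x y} = ⋂ i, {y | |y i - x i| < δ} := by
    ext y; simp [Nr]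
  rw [this]
  refine isOpen_iInter_of_finite fun i => ?_
  exact isOpen_lt (by fun_prop) continuous_const

theorem isClosed_nr {ι : Type} (δ : R) (x : ι → R) : IsClosed {y : ι → R | ∀ i, |y i - x i| ≤ δ} := by
  have : {y : ι → R | ∀ i, |y i - x i| ≤ δ} = ⋂ i, {y | |y i - x i| ≤ δ} := by
    ext y; simp
  rw [this]
  refine isClosed_iInter fun i => ?_
  exact isClosed_le (by fun_prop) continuous_const

theorem ev_le {δ : R} (h : 0 < δ) : ∀ᶠ t in 𝓝[>] (0 : R), t ≤ δ :=
  mem_nhdsWithin_of_mem_nhds (Iic_mem_nhds h)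

theorem ev_pos : ∀ᶠ t in 𝓝[>] (0 : R), 0 < t := self_mem_nhdsWithin

theorem exists_of_ev {p : R → Prop} (h : ∀ᶠ t in 𝓝[>] (0 : R), p t) : ∃ t, 0 < t ∧ p t :=
  (ev_pos.and h).exists

theorem ev_of_exists {p : R → Prop} (hm : ∀ s t, 0 < s → s ≤ t → p t → p s) {t : R} (ht : 0 < t)
    (hp : p t) : ∀ᶠ t in 𝓝[>] (0 : R), p t := by
  filter_upwards [ev_le ht, ev_pos] with s hs h0
  exact hm s t h0 hs hp

theorem exists_nr {ι : Type} [Finite ι] {O : Set (ι → R)} (hO : IsOpen O) {x : ι → R} (hx : x ∈ O) :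
    ∃ δ : R, 0 < δ ∧ ∀ y, Nr δ x y → y ∈ O := by
  obtain ⟨u, hu, hsub⟩ := isOpen_pi_iff'.1 hO x hx
  have : ∀ i, ∀ᶠ δ in 𝓝[>] (0 : R), ∀ y, |y - x i| < δ → y ∈ u i := fun i => by
    obtain ⟨δ, hδ, h⟩ := (nhds_basis_abs_sub_lt (x i)).mem_iff.1 ((hu i).1.mem_nhds (hu i).2)
    exact ev_of_exists (fun s t _ hst h y hy => h y (hy.trans_le hst)) hδ (fun y hy => h hy)
  obtain ⟨δ, hδ, h⟩ := exists_of_ev (Filter.eventually_all.2 this)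
  exact ⟨δ, hδ, fun y hy => hsub fun i _ => h i _ (hy i)⟩

theorem exists_nr1 {O : Set R} (hO : IsOpen O) {x : R} (hx : x ∈ O) :
    ∃ δ : R, 0 < δ ∧ ∀ y, |y - x| < δ → y ∈ O := by
  obtain ⟨δ, hδ, h⟩ := (nhds_basis_abs_sub_lt x).mem_iff.1 (hO.mem_nhds hx)
  exact ⟨δ, hδ, fun y hy => h hy⟩

theorem exists_half {s : R} (hs : 0 < s) : ∃ t, 0 < t ∧ t + t < s := by
  obtain ⟨u, hu0, hus⟩ := exists_between hs
  obtain ⟨t, ht0, ht⟩ := exists_between (lt_min hu0 (sub_pos.2 hus))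
  refine ⟨t, ht0, ?_⟩
  have h1 := ht.trans_le (min_le_left _ _)
  have h2 := ht.trans_le (min_le_right _ _)
  calc t + t < u + (s - u) := add_lt_add h1 h2
    _ = s := by abel

theorem Dfn.nr [GS L R] {ι κ : Type} [Finite κ] {δ : (ι → R) → R} {x y : (ι → R) → κ → R}
    (hδ : DFn L δ) (hx : ∀ k, DFn L (fun v => x v k)) (hy : ∀ k, DFn L (fun v => y v k)) :
    Dfn L (fun v => Nr (δ v) (x v) (y v)) := by
  unfold Nr
  exact Dfn.finAll fun k => Dfn.absLt ((hy k).sub (hx k)) hδ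

theorem dc_sup [GS L R] {S : R → Prop} (hS : Dfn L (fun v : Unit → R => S (v ())))
    (hne : ∃ x, S x) (hb : ∃ b, ∀ x, S x → x ≤ b) : ∃ a, IsLUB {x | S x} a := by
  refine GS.dc (L := L) {x | S x} ?_ hne ?_
  · exact dfn_iff.2 (Dfn.reindex hS (fun _ => (0 : Fin 1)))
  · obtain ⟨b, hb⟩ := hb
    exact ⟨b, fun x hx => hb x hx⟩

theorem dc_inf [GS L R] {S : R → Prop} (hS : Dfn L (fun v : Unit → R => S (v ())))
    (hne : ∃ x, S x) (hb : ∃ b, ∀ x, S x → b ≤ x) : ∃ a, IsGLB {x | S x} a := by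
  have : ∃ a, IsLUB {x | ∀ y, S y → x ≤ y} a := by
    refine dc_sup (L := L) ?_ hb ?_
    · refine Dfn.all (Dfn.imp ?_ (Dfn.le (DFn.var _) (DFn.var _)))
      exact Dfn.reindex hS (fun _ => Sum.inr ())
    · obtain ⟨x, hx⟩ := hne
      exact ⟨x, fun y hy => hy x hx⟩
  obtain ⟨a, ha⟩ := this
  refine ⟨a, isLUB_lowerBounds.1 ?_⟩
  convert ha using 1
  ext x
  exact ⟨fun h y hy => h hy, fun h y hy => h y hy⟩

theorem real_ind [GS L R] {S : R → Prop} (hS : Dfn L (fun v : Unit → R => S (v ()))) {c e : R}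
    (hce : c ≤ e)
    (h : ∀ t, c ≤ t → t ≤ e → (∀ s, c ≤ s → s < t → S s) →
      ∃ δ, 0 < δ ∧ ∀ s, c ≤ s → s ≤ e → s < t + δ → S s) :
    ∀ s, c ≤ s → s ≤ e → S s := by
  let S' : R → Prop := fun s => c ≤ s ∧ s ≤ e ∧ ∀ s', c ≤ s' → s' ≤ s → S s'
  have hc : S' c := by
    refine ⟨le_rfl, hce, fun s' h1 h2 => ?_⟩
    obtain ⟨δ, hδ, h3⟩ := h c le_rfl hce (fun s h1 h2 => absurd h2 (not_lt.2 h1))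
    exact h3 s' h1 (h2.trans hce) (h2.trans_lt (lt_add_of_pos_right _ hδ))
  obtain ⟨t, ht⟩ : ∃ t, IsLUB {s | S' s} t := by
    refine dc_sup (L := L) ?_ ⟨c, hc⟩ ⟨e, fun x hx => hx.2.1⟩
    refine Dfn.and (Dfn.le (DFn.const _) (DFn.var _)) (Dfn.and (Dfn.le (DFn.var _) (DFn.const _)) ?_)
    refine Dfn.all (Dfn.imp (Dfn.le (DFn.const _) (DFn.var _))
      (Dfn.imp (Dfn.le (DFn.var _) (DFn.var _)) ?_))
    exact Dfn.reindex hS (fun _ => Sum.inr ())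
  have hct : c ≤ t := ht.1 hc
  have hte : t ≤ e := ht.2 fun s hs => hs.2.1
  obtain ⟨δ, hδ, h3⟩ := h t hct hte (fun s h1 h2 => by
    obtain ⟨u, hu, hsu⟩ := (lt_isLUB_iff ht).1 h2
    exact hu.2.2 s h1 hsu.le)
  have hlt : ¬ t < e := by
    intro hlt
    obtain ⟨s, hts, hs⟩ := exists_between (lt_min hlt (lt_add_of_pos_right t hδ))
    have h1 := hs.trans_le (min_le_left _ _)
    have h2 := hs.trans_le (min_le_right _ _)
    have : S' s := ⟨hct.trans hts.le, h1.le, fun s' h4 h5 => h3 s' h4 (h5.trans h1.le) (h5.trans_lt h2)⟩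
    exact absurd (ht.1 this) (not_le.2 hts)
  have hte' : t = e := le_antisymm hte (not_lt.1 hlt)
  intro s h1 h2
  exact h3 s h1 h2 (by rw [hte']; exact h2.trans_lt (lt_add_of_pos_right _ hδ))

theorem proj_closed1 [GS L R] {ι : Type} [Finite ι] {P : (ι → R) → R → Prop}
    (hdef : Dfn L (fun w : ι ⊕ Unit → R => P (fun i => w (Sum.inl i)) (w (Sum.inr ()))))
    (hcl : IsClosed {p : (ι → R) × R | P p.1 p.2}) {c e : R}
    (hb : ∀ v y, P v y → c ≤ y ∧ y ≤ e) : IsClosed {v | ∃ y, P v y} := by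
  rw [← isOpen_compl_iff, isOpen_iff_forall_mem_open]
  intro z hz
  have hz' : ∀ y, ¬ P z y := fun y hy => hz ⟨y, hy⟩
  rcases lt_or_ge e c with hce | hce
  · refine ⟨univ, fun v _ => ?_, isOpen_univ, mem_univ _⟩
    rintro ⟨y, hy⟩
    have := hb _ _ hy
    exact absurd (this.1.trans this.2) (not_le.2 hce)
  let S : R → Prop := fun t => ∃ δ, 0 < δ ∧ ∀ z' : ι → R, Nr δ z z' → ∀ y, y ≤ t → ¬ P z' y
  have hS : Dfn L (fun v : Unit → R => S (v ())) := by
    refine Dfn.ex (Dfn.and (Dfn.lt (DFn.const _) (DFn.var _)) (Dfn.alls (Dfn.imp ?_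
      (Dfn.all (Dfn.imp (Dfn.le (DFn.var _) (DFn.var _)) (Dfn.not ?_))))))
    · exact Dfn.nr (DFn.var _) (fun k => DFn.const _) (fun k => DFn.var _)
    · exact Dfn.reindex hdef (fun k => match k with
        | Sum.inl i => Sum.inl (Sum.inr i)
        | Sum.inr _ => Sum.inr ())
  have := real_ind (L := L) (S := S) hS hce (fun t hct hte hlt => by
    have ho : IsOpen {p : (ι → R) × R | ¬ P p.1 p.2} := hcl.isOpen_compl
    obtain ⟨U, V, hU, hV, hzU, htV, hUV⟩ := isOpen_prod_iff.1 ho z t (hz' t)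
    obtain ⟨δ1, hδ1, h1⟩ := exists_nr hU hzU
    obtain ⟨δ2, hδ2, h2⟩ := exists_nr1 hV htV
    refine ⟨δ2, hδ2, fun s hcs hse hst => ?_⟩
    rcases eq_or_lt_of_le hct with rfl | hct
    · refine ⟨δ1, hδ1, fun z' hz' y hys hP => ?_⟩
      have h3 := (hb _ _ hP).1
      refine hUV (mk_mem_prod (h1 _ hz') (h2 y ?_)) hP
      rw [abs_of_nonneg (sub_nonneg.2 h3), sub_lt_iff_lt_add']
      exact hys.trans_lt hst
    · obtain ⟨δ3, h03, h32⟩ := exists_between hδ2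
      obtain ⟨δ4, hδ4, h4⟩ := hlt (max c (t - δ3)) (le_max_left _ _)
        (max_lt hct (sub_lt_self _ h03))
      refine ⟨min δ1 δ4, lt_min hδ1 hδ4, fun z' hz' y hys hP => ?_⟩
      rcases le_or_gt y (max c (t - δ3)) with hy | hy
      · exact h4 z' (hz'.mono (min_le_right _ _)) y hy hP
      · refine hUV (mk_mem_prod (h1 _ (hz'.mono (min_le_left _ _))) (h2 y ?_)) hP
        rw [abs_lt]
        have h5 := (le_max_right _ _).trans_lt hy
        constructor
        · rw [neg_lt_sub_iff_lt_add, ← sub_lt_iff_lt_add]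
          exact sub_lt_comm.1 ((sub_lt_sub_left h32 t).trans h5)
        · rw [sub_lt_iff_lt_add']
          exact hys.trans_lt hst) e hce le_rfl
  obtain ⟨δ, hδ, h⟩ := this
  refine ⟨{z' | Nr δ z z'}, fun v hv => ?_, isOpen_nr δ z, Nr.refl hδ z⟩
  rintro ⟨y, hy⟩
  exact h v hv y (hb _ _ hy).2 hy

theorem proj_closed [GS L R] {κ : Type} [Finite κ] : ∀ {ι : Type} [Finite ι]
    {P : (ι → R) → (κ → R) → Prop}
    (hdef : Dfn L (fun w : ι ⊕ κ → R => P (fun i => w (Sum.inl i)) (fun k => w (Sum.inr k))))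
    (hcl : IsClosed {p : (ι → R) × (κ → R) | P p.1 p.2}) {c e : R}
    (hb : ∀ v w, P v w → ∀ k, c ≤ w k ∧ w k ≤ e), IsClosed {v | ∃ w, P v w} := by
  refine Finite.induction_empty_option (P := fun κ : Type => ∀ {ι : Type} [Finite ι]
    {P : (ι → R) → (κ → R) → Prop}
    (hdef : Dfn L (fun w : ι ⊕ κ → R => P (fun i => w (Sum.inl i)) (fun k => w (Sum.inr k))))
    (hcl : IsClosed {p : (ι → R) × (κ → R) | P p.1 p.2}) {c e : R}
    (hb : ∀ v w, P v w → ∀ k, c ≤ w k ∧ w k ≤ e), IsClosed {v | ∃ w, P v w}) ?_ ?_ ?_ κ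
  · intro α β eq ih ι _ P hdef hcl c e hb
    have := ih (ι := ι) (P := fun v w => P v (fun b => w (eq.symm b)))
      (Dfn.reindex hdef (fun k => match k with
        | Sum.inl i => Sum.inl i
        | Sum.inr j => Sum.inr (eq.symm j)))
      (hcl.preimage (f := fun p : (ι → R) × (α → R) => (p.1, fun b => p.2 (eq.symm b)))
        (by fun_prop)) (c := c) (e := e)
      (fun v w h k => by simpa using hb _ _ h (eq k))
    convert this using 1
    ext v
    constructor
    · rintro ⟨w, hw⟩
      exact ⟨fun a => w (eq a), by simpa using hw⟩
    · rintro ⟨w, hw⟩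
      exact ⟨_, hw⟩
  · intro ι _ P hdef hcl c e hb
    have : {v | ∃ w, P v w} = (fun v : ι → R => (v, fun k : PEmpty => k.elim)) ⁻¹'
        {p : (ι → R) × (PEmpty → R) | P p.1 p.2} := by
      ext v
      constructor
      · rintro ⟨w, hw⟩
        have : w = fun k : PEmpty => k.elim := funext fun k => k.elim
        exact this ▸ hw
      · intro h; exact ⟨_, h⟩
    rw [this]
    exact hcl.preimage (by fun_prop)
  · intro α _ ih ι _ P hdef hcl c e hb
    have h1 := ih (ι := ι) (P := fun v w => ∃ y, P v (fun o => o.elim y w)) ?_ ?_ (c := c) (e := e)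
      (fun v w ⟨y, h⟩ k => hb _ _ h (some k))
    · convert h1 using 1
      ext v
      constructor
      · rintro ⟨w, hw⟩
        refine ⟨fun a => w (some a), w none, ?_⟩
        convert hw using 1
        ext o; cases o <;> rfl
      · rintro ⟨w, y, hw⟩
        exact ⟨_, hw⟩
    · refine Dfn.ex ?_
      have := Dfn.reindex hdef (ι := (ι ⊕ α) ⊕ Unit) (fun k => match k with
        | Sum.inl i => Sum.inl (Sum.inl i)
        | Sum.inr none => Sum.inr ()
        | Sum.inr (some a) => Sum.inl (Sum.inr a))
      refine this.congr fun v => ?_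
      have : (fun o : Option α => o.elim (v (Sum.inr ())) fun k => v (Sum.inl (Sum.inr k))) = 
          fun o : Option α => v (match (Sum.inr o : ι ⊕ Option α) with
            | Sum.inl i => Sum.inl (Sum.inl i)
            | Sum.inr none => Sum.inr ()
            | Sum.inr (some a) => Sum.inl (Sum.inr a)) := by
        ext o; cases o <;> rfl
      rw [this]
    · have h2 := proj_closed1 (L := L) (ι := ι ⊕ α) (c := c) (e := e)
        (P := fun v y => P (fun i => v (Sum.inl i)) (fun o => o.elim y (fun a => v (Sum.inr a)))) ?_ ?_
        (fun v y h => hb _ _ h none)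
      · exact h2.preimage (f := fun p : (ι → R) × (α → R) => Sum.elim p.1 p.2) (by
          refine continuous_pi fun k => ?_
          cases k
          · exact (continuous_apply _).comp continuous_fst
          · exact (continuous_apply _).comp continuous_snd)
      · have := Dfn.reindex hdef (ι := (ι ⊕ α) ⊕ Unit) (fun k => match k with
          | Sum.inl i => Sum.inl (Sum.inl i)
          | Sum.inr none => Sum.inr ()
          | Sum.inr (some a) => Sum.inl (Sum.inr a))
        refine this.congr fun v => ?_
        have : (fun o : Option α => o.elim (v (Sum.inr ())) fun k => v (Sum.inl (Sum.inr k))) = 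
            fun o : Option α => v (match (Sum.inr o : ι ⊕ Option α) with
              | Sum.inl i => Sum.inl (Sum.inl i)
              | Sum.inr none => Sum.inr ()
              | Sum.inr (some a) => Sum.inl (Sum.inr a)) := by
          ext o; cases o <;> rfl
        rw [this]
      · refine hcl.preimage (f := fun p : ((ι ⊕ α) → R) × R =>
          ((fun i => p.1 (Sum.inl i)), fun o : Option α => o.elim p.2 (fun a => p.1 (Sum.inr a)))) ?_
        refine Continuous.prodMk (by fun_prop) (continuous_pi fun o => ?_)
        cases o
        · exact continuous_snd
        · exact (continuous_apply _).comp continuous_fst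

end Basic

section Arity

variable {L : FirstOrder.Language} {R : Type*} [L.Structure R] {ι κ : Type}

/-- Definable families of predicates with one extra variable. -/
def Dfn1 (L : FirstOrder.Language) {R : Type*} [L.Structure R] {ι : Type}
    (Q : (ι → R) → R → Prop) : Prop :=
  Dfn L (fun w : ι ⊕ Fin 1 → R => Q (fun i => w (Sum.inl i)) (w (Sum.inr 0)))

/-- Definable families of predicates with two extra variables. -/
def Dfn2 (L : FirstOrder.Language) {R : Type*} [L.Structure R] {ι : Type}
    (Q : (ι → R) → R → R → Prop) : Prop :=
  Dfn L (fun w : ι ⊕ Fin 2 → R => Q (fun i => w (Sum.inl i)) (w (Sum.inr 0)) (w (Sum.inr 1)))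

/-- Definable families of predicates with three extra variables. -/
def Dfn3 (L : FirstOrder.Language) {R : Type*} [L.Structure R] {ι : Type}
    (Q : (ι → R) → R → R → R → Prop) : Prop :=
  Dfn L (fun w : ι ⊕ Fin 3 → R => Q (fun i => w (Sum.inl i)) (w (Sum.inr 0)) (w (Sum.inr 1))
    (w (Sum.inr 2)))

theorem Dfn1.app [Finite ι] {Q : (ι → R) → R → Prop} (h : Dfn1 L Q) {x : (κ → R) → ι → R}
    {s : (κ → R) → R} (hx : ∀ i, DFn L (fun v => x v i)) (hs : DFn L s) :
    Dfn L (fun v => Q (x v) (s v)) := by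
  refine Dfn.subst (t := fun v => Sum.elim (x v) ![s v]) h fun k => ?_
  rcases k with i | k
  · exact hx i
  · fin_cases k
    exact hs

theorem Dfn2.app [Finite ι] {Q : (ι → R) → R → R → Prop} (h : Dfn2 L Q) {x : (κ → R) → ι → R}
    {s t : (κ → R) → R} (hx : ∀ i, DFn L (fun v => x v i)) (hs : DFn L s) (ht : DFn L t) :
    Dfn L (fun v => Q (x v) (s v) (t v)) := by
  refine Dfn.subst (t := fun v => Sum.elim (x v) ![s v, t v]) h fun k => ?_
  rcases k with i | k
  · exact hx i
  · fin_cases k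
    · exact hs
    · exact ht

theorem Dfn3.app [Finite ι] {Q : (ι → R) → R → R → R → Prop} (h : Dfn3 L Q) {x : (κ → R) → ι → R}
    {s t u : (κ → R) → R} (hx : ∀ i, DFn L (fun v => x v i)) (hs : DFn L s) (ht : DFn L t)
    (hu : DFn L u) : Dfn L (fun v => Q (x v) (s v) (t v) (u v)) := by
  refine Dfn.subst (t := fun v => Sum.elim (x v) ![s v, t v, u v]) h fun k => ?_
  rcases k with i | k
  · exact hx i
  · fin_cases k
    · exact hs
    · exact ht
    · exact hu

end Arity

section OneDim

variable {L : FirstOrder.Language} {R : Type*} [L.Structure R] [AddCommGroup R] [LinearOrder R]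
  [IsOrderedAddMonoid R] [DenselyOrdered R] [Nontrivial R] [TopologicalSpace R] [OrderTopology R]
  {ι : Type} [Finite ι]

theorem luf_general [GS L R] {Z : (ι → R) → R → Prop} (hZ : Dfn1 L Z) (a : R) (b : ι → R) :
    ∃ N : ℕ, ∃ δ : R, 0 < δ ∧ ∀ x, Nr δ b x → (∀ y, Z x y → |y - a| < δ) →
      {y | Z x y}.Infinite ∨ {y | Z x y}.ncard ≤ N := by
  obtain ⟨m, ⟨eq⟩⟩ := Finite.exists_equiv_fin ι
  obtain ⟨N, -, p, q, hpq, U, ⟨c, e, rfl⟩, hbU, h⟩ := GS.luf (L := L) m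
    {v : Fin (m + 1) → R | Z (fun i => v (Fin.castSucc (eq i))) (v (Fin.last m))}
    (dfn_iff.2 (Dfn1.app hZ (fun i => DFn.var _) (DFn.var _))) a (fun k => b (eq.symm k))
  obtain ⟨δ1, hδ1, h1⟩ := exists_nr1 isOpen_interior hpq
  obtain ⟨δ2, hδ2, h2⟩ := exists_nr (isOpen_inBox c e) hbU
  refine ⟨N, min δ1 δ2, lt_min hδ1 hδ2, fun x hx hy => ?_⟩
  have h3 := h (fun k => x (eq.symm k)) (h2 _ fun k => (hx _).trans_le (min_le_right _ _)) p q hpq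
    (Subset.refl _)
  have h4 : fiber1 {v : Fin (m + 1) → R | Z (fun i => v (Fin.castSucc (eq i))) (v (Fin.last m))}
      (fun k => x (eq.symm k)) ∩ Icc p q = {y | Z x y} := by
    ext y
    simp only [fiber1, mem_inter_iff, mem_ofPred_eq, Fin.snoc_castSucc, Fin.snoc_last,
      Equiv.symm_apply_apply]
    refine ⟨fun h => h.1, fun h => ⟨h, ?_⟩⟩
    exact interior_subset (h1 y ((hy y h).trans_le (min_le_left _ _)))
  rwa [h4] at h3

/-- Separated sets. -/
def SepBy (t : R) (Z : R → Prop) : Prop := ∀ y y', Z y → Z y' → y < y' → y + t ≤ y'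

theorem SepBy.mono {s t : R} (h : s ≤ t) {Z : R → Prop} (hZ : SepBy t Z) : SepBy s Z :=
  fun y y' h1 h2 h3 => (add_le_add_right h y).trans (hZ y y' h1 h2 h3)

theorem sep_min [GS L R] {Z : R → Prop} (hZ : Dfn L (fun v : Unit → R => Z (v ()))) {t : R}
    (ht : 0 < t) (hs : SepBy t Z) (c : R) (hne : ∃ y, Z y ∧ c < y) :
    ∃ y0, Z y0 ∧ c < y0 ∧ ∀ y, Z y → c < y → y0 ≤ y := by
  obtain ⟨m, hm⟩ := dc_inf (L := L) (S := fun y => Z y ∧ c < y)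
    (hZ.and (Dfn.lt (DFn.const _) (DFn.var _))) hne ⟨c, fun x hx => hx.2.le⟩
  obtain ⟨y, hy, hyt⟩ := (isGLB_lt_iff hm).1 (lt_add_of_pos_right m ht)
  refine ⟨y, hy.1, hy.2, fun y' h1 h2 => ?_⟩
  by_contra hlt
  have h3 := hs y' y h1 hy.1 (not_le.1 hlt)
  have h4 : m ≤ y' := hm.1 ⟨h1, h2⟩
  exact absurd ((add_le_add_left h4 t).trans h3) (not_le.2 hyt)

theorem sep_count [GS L R] {Z : R → Prop} (hZ : Dfn L (fun v : Unit → R => Z (v ()))) {t : R}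
    (ht : 0 < t) (hs : SepBy t Z) {u w : R} (huw : u ≤ w) (k : ℕ)
    (hF : ∃ F : Finset R, (∀ y ∈ F, Z y ∧ u < y ∧ y ≤ w) ∧ k ≤ F.card) :
    ∃ w', u ≤ w' ∧ w' ≤ w ∧ {y | Z y ∧ u < y ∧ y ≤ w'}.Finite ∧
      {y | Z y ∧ u < y ∧ y ≤ w'}.ncard = k := by
  induction k with
  | zero =>
    have : {y | Z y ∧ u < y ∧ y ≤ u} = ∅ := by
      ext y
      simp only [mem_ofPred_eq, mem_empty_iff_false, iff_false]
      exact fun h => absurd h.2.1 (not_lt.2 h.2.2)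
    exact ⟨u, le_rfl, huw, by rw [this]; simp, by rw [this]; simp⟩
  | succ k ih =>
    obtain ⟨F, hF, hk⟩ := hF
    obtain ⟨w', h1, h2, h3, h4⟩ := ih ⟨F, hF, by omega⟩
    have : ∃ y ∈ F, w' < y := by
      by_contra hcon
      push Not at hcon
      have hsub : (F : Set R) ⊆ {y | Z y ∧ u < y ∧ y ≤ w'} := fun y hy =>
        ⟨(hF y hy).1, (hF y hy).2.1, hcon y hy⟩
      have := Set.ncard_le_ncard hsub h3
      rw [Set.ncard_coe_finset] at this
      omega
    obtain ⟨y, hyF, hy⟩ := this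
    obtain ⟨y0, h5, h6, h7⟩ := sep_min hZ ht hs w' ⟨y, (hF y hyF).1, hy⟩
    have heq : {y | Z y ∧ u < y ∧ y ≤ y0} = insert y0 {y | Z y ∧ u < y ∧ y ≤ w'} := by
      ext z
      simp only [mem_ofPred_eq, mem_insert_iff]
      constructor
      · rintro ⟨ha, hb, hc⟩
        rcases le_or_gt z w' with hz | hz
        · exact Or.inr ⟨ha, hb, hz⟩
        · exact Or.inl (le_antisymm hc (h7 z ha hz))
      · rintro (rfl | ⟨ha, hb, hc⟩)
        · exact ⟨h5, h1.trans_lt h6, le_rfl⟩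
        · exact ⟨ha, hb, hc.trans h6.le⟩
    refine ⟨y0, h1.trans h6.le, (h7 y (hF y hyF).1 hy).trans (hF y hyF).2.2, ?_, ?_⟩
    · rw [heq]; exact h3.insert _
    · rw [heq, Set.ncard_insert_of_notMem _ h3, h4]
      exact fun h => absurd h.2.2 (not_le.2 h6)

theorem sep_bound [GS L R] {Z : (ι → R) → R → R → Prop} (hZ : Dfn2 L Z) (a : R) (b : ι → R) :
    ∃ N : ℕ, ∃ δ : R, 0 < δ ∧ ∀ x t, Nr δ b x → 0 < t → t < δ → SepBy t (Z x t) →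
      ∀ F : Finset R, (∀ y ∈ F, Z x t y ∧ |y - a| < δ) → F.card ≤ N := by
  obtain ⟨N, δ0, hδ0, h⟩ := luf_general (L := L) (ι := ι ⊕ Fin 3)
    (Z := fun w y => Z (fun i => w (Sum.inl i)) (w (Sum.inr 0)) y ∧ w (Sum.inr 1) < y ∧
      y ≤ w (Sum.inr 2))
    (by
      refine Dfn.and (Dfn2.app hZ (fun i => DFn.var _) (DFn.var _) (DFn.var _))
        (Dfn.and (Dfn.lt (DFn.var _) (DFn.var _)) (Dfn.le (DFn.var _) (DFn.var _))))
    a (Sum.elim b ![0, a, a])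
  obtain ⟨δ, hδ, hδδ⟩ := exists_between hδ0
  refine ⟨N, δ, hδ, fun x t hx ht htδ hs F hF => ?_⟩
  by_contra hcard
  have hdef : Dfn L (fun v : Unit → R => Z x t (v ())) :=
    Dfn2.app hZ (fun i => DFn.const _) (DFn.const _) (DFn.var _)
  have huw : a - δ ≤ a + δ := by
    rw [sub_eq_add_neg]; exact add_le_add_right ((neg_neg_of_pos hδ).le.trans hδ.le) a
  obtain ⟨w', h1, h2, h3, h4⟩ := sep_count hdef ht hs huw (N + 1)
    ⟨F, fun y hy => ⟨(hF y hy).1, by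
      have := abs_sub_lt_iff.1 (hF y hy).2
      exact ⟨sub_lt_comm.1 this.2, (sub_lt_iff_lt_add'.1 this.1).le⟩⟩, by omega⟩
  have hw' : |w' - a| ≤ δ := abs_sub_le_iff.2 ⟨sub_le_iff_le_add'.2 h2, sub_le_comm.1 h1⟩
  have h5 := h (Sum.elim x ![t, a - δ, w']) (by
    intro k
    rcases k with i | k
    · exact (hx i).trans hδδ
    · fin_cases k
      · show |t - 0| < δ0
        rw [sub_zero, abs_of_pos ht]; exact htδ.trans hδδ
      · show |a - δ - a| < δ0
        rw [sub_sub_cancel_left, abs_neg, abs_of_pos hδ]; exact hδδ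
      · exact hw'.trans_lt hδδ) (by
    rintro y ⟨hy1, hy2, hy3⟩
    have hy2 : a - δ < y := hy2
    have hy3 : y ≤ w' := hy3
    refine lt_of_le_of_lt ?_ hδδ
    exact abs_sub_le_iff.2 ⟨sub_le_iff_le_add'.2 (hy3.trans h2), sub_le_comm.1 hy2.le⟩)
  have h6 : {y | Z x t y ∧ a - δ < y ∧ y ≤ w'}.Infinite ∨
    {y | Z x t y ∧ a - δ < y ∧ y ≤ w'}.ncard ≤ N := h5
  rcases h6 with h6 | h6
  · exact h6 h3
  · omega

theorem Dfn.sep [GS L R] {κ : Type} {t : (κ → R) → R} {Z : (κ → R) → R → Prop} (ht : DFn L t)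
    (hZ : ∀ {κ' : Type} (g : κ → κ') (s : (κ' → R) → R), DFn L s →
      Dfn L (fun v : κ' → R => Z (fun k => v (g k)) (s v)))
    (ht' : ∀ {κ' : Type} (g : κ → κ'), DFn L (fun v : κ' → R => t (fun k => v (g k)))) :
    Dfn L (fun v => SepBy (t v) (Z v)) := by
  unfold SepBy
  refine Dfn.all (Dfn.all (Dfn.imp ?_ (Dfn.imp ?_ (Dfn.imp (Dfn.lt (DFn.var _) (DFn.var _))
    (Dfn.le (DFn.add (DFn.var _) ?_) (DFn.var _))))))
  · exact hZ _ _ (DFn.var _)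
  · exact hZ _ _ (DFn.var _)
  · exact ht' _

theorem chain_bound [GS L R] {C : (ι → R) → R → R → Prop} (hC : Dfn2 L C)
    (hch : ∀ x r r', (∀ y, C x r y → C x r' y) ∨ (∀ y, C x r' y → C x r y)) (a : R) (b : ι → R) :
    ∃ N : ℕ, ∃ δ : R, 0 < δ ∧ ∀ x, Nr δ b x → (∀ r, ∃ t, 0 < t ∧ SepBy t (C x r)) →
      ∀ F : Finset R, (∀ y ∈ F, (∃ r, C x r y) ∧ |y - a| < δ) → F.card ≤ N := by
  obtain ⟨N, δ, hδ, h⟩ := sep_bound (L := L) (Z := fun x t y => ∃ r, C x r y ∧ SepBy t (C x r))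
    (by
      refine Dfn.ex (Dfn.and (Dfn2.app hC (fun i => DFn.var _) (DFn.var _) (DFn.var _)) ?_)
      unfold SepBy
      refine Dfn.all (Dfn.all (Dfn.imp ?_ (Dfn.imp ?_ (Dfn.imp (Dfn.lt (DFn.var _) (DFn.var _))
        (Dfn.le (DFn.add (DFn.var _) (DFn.var _)) (DFn.var _))))))
      · exact Dfn2.app hC (fun i => DFn.var _) (DFn.var _) (DFn.var _)
      · exact Dfn2.app hC (fun i => DFn.var _) (DFn.var _) (DFn.var _)) a b
  refine ⟨N, δ, hδ, fun x hx hsep F hF => ?_⟩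
  have h1 : ∀ y ∈ F, ∀ᶠ t in 𝓝[>] (0 : R), ∃ r, C x r y ∧ SepBy t (C x r) := by
    intro y hy
    obtain ⟨⟨r, hr⟩, -⟩ := hF y hy
    obtain ⟨t, ht, hst⟩ := hsep r
    exact ev_of_exists (fun s t _ hst ⟨r, h1, h2⟩ => ⟨r, h1, h2.mono hst⟩) ht ⟨r, hr, hst⟩
  have h2 : ∀ᶠ t in 𝓝[>] (0 : R), t < δ := mem_nhdsWithin_of_mem_nhds (Iio_mem_nhds hδ)
  obtain ⟨t, ht, h3, h4⟩ := exists_of_ev (((Filter.eventually_all_finset F).2 h1).and h2)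
  refine h x t hx ht h4 ?_ F (fun y hy => ⟨h3 y hy, (hF y hy).2⟩)
  rintro y y' ⟨r, hr, hs⟩ ⟨r', hr', hs'⟩ hyy
  rcases hch x r r' with hc | hc
  · exact hs' y y' (hc y hr) hr' hyy
  · exact hs y y' hr (hc y' hr') hyy

/-- Locally discrete and closed. -/
def LDs (C : R → Prop) : Prop := ∀ a : R, ∃ δ, 0 < δ ∧ ∀ y, C y → |y - a| < δ → y = a

theorem lds_of_finite {S : Set R} (hS : S.Finite) (a : R) :
    ∃ δ, 0 < δ ∧ ∀ y ∈ S, |y - a| < δ → y = a := by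
  have h1 : IsOpen ((S \ {a})ᶜ) := (hS.subset sdiff_subset).isClosed.isOpen_compl
  obtain ⟨δ, hδ, h⟩ := exists_nr1 h1 (x := a) (by simp)
  refine ⟨δ, hδ, fun y hy hya => ?_⟩
  by_contra hne
  exact h y hya ⟨hy, hne⟩

theorem finite_of_bound {S : Set R} {N : ℕ} (h : ∀ F : Finset R, (∀ y ∈ F, y ∈ S) → F.card ≤ N) :
    S.Finite := by
  by_contra hinf
  obtain ⟨F, hF, hc⟩ := (Set.not_finite.1 hinf).exists_subset_card_eq (N + 1)
  have := h F (fun y hy => hF hy)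
  omega

theorem lds_of_bound {C : R → Prop} (h : ∀ a : R, ∃ N : ℕ, ∃ δ : R, 0 < δ ∧
    ∀ F : Finset R, (∀ y ∈ F, C y ∧ |y - a| < δ) → F.card ≤ N) : LDs C := by
  intro a
  obtain ⟨N, δ, hδ, h⟩ := h a
  have hfin : {y | C y ∧ |y - a| < δ}.Finite := finite_of_bound (N := N) h
  obtain ⟨δ', hδ', h'⟩ := lds_of_finite hfin a
  exact ⟨min δ δ', lt_min hδ hδ', fun y hy hya => h' y ⟨hy, hya.trans_le (min_le_left _ _)⟩
    (hya.trans_le (min_le_right _ _))⟩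

theorem sep_of_lds [GS L R] {C : R → Prop} (hdef : Dfn L (fun v : Unit → R => C (v ())))
    (hC : LDs C) {p q : R} (hb : ∀ y, C y → p ≤ y ∧ y ≤ q) : ∃ t, 0 < t ∧ SepBy t C := by
  rcases lt_or_ge q p with hqp | hpq
  · obtain ⟨t, ht⟩ := exists_gt (0 : R)
    exact ⟨t, ht, fun y y' hy => absurd ((hb y hy).1.trans (hb y hy).2) (not_le.2 hqp)⟩
  have := real_ind (L := L) (S := fun u => ∃ t, 0 < t ∧ SepBy t (fun y => C y ∧ y ≤ u)) (by
    refine Dfn.ex (Dfn.and (Dfn.lt (DFn.const _) (DFn.var _)) ?_)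
    unfold SepBy
    refine Dfn.all (Dfn.all (Dfn.imp ?_ (Dfn.imp ?_ (Dfn.imp (Dfn.lt (DFn.var _) (DFn.var _))
        (Dfn.le (DFn.add (DFn.var _) (DFn.var _)) (DFn.var _))))))
    · exact Dfn.and (Dfn.reindex hdef (fun _ => Sum.inl (Sum.inr ()))) (Dfn.le (DFn.var _) (DFn.var _))
    · exact Dfn.and (Dfn.reindex hdef (fun _ => Sum.inr ())) (Dfn.le (DFn.var _) (DFn.var _)))
    hpq (by
      intro u hpu huq hlt
      obtain ⟨δ, hδ, hδu⟩ := hC u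
      refine ⟨δ, hδ, fun s hps hsq hsu => ?_⟩
      rcases eq_or_lt_of_le hpu with rfl | hpu
      · refine ⟨δ, hδ, ?_⟩
        have : ∀ y, C y ∧ y ≤ s → y = p := by
          rintro y ⟨hy, hys⟩
          refine hδu y hy ?_
          rw [abs_of_nonneg (sub_nonneg.2 (hb y hy).1), sub_lt_iff_lt_add']
          exact hys.trans_lt hsu
        intro y y' hy hy' hyy
        rw [this y hy, this y' hy'] at hyy
        exact absurd hyy (lt_irrefl _)
      · obtain ⟨δ', hδ', hδδ⟩ := exists_between hδ
        have hlt' : max p (u - δ') < u := max_lt hpu (sub_lt_self _ hδ')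
        obtain ⟨t1, ht1, hs1⟩ := hlt (max p (u - δ')) (le_max_left _ _) hlt'
        have key : ∀ y, C y ∧ y ≤ s → (y ≤ max p (u - δ') ∨ y = u) := by
          rintro y ⟨hy, hys⟩
          rcases le_or_gt y (max p (u - δ')) with h | h
          · exact Or.inl h
          · refine Or.inr (hδu y hy ?_)
            have h5 := (le_max_right _ _).trans_lt h
            refine abs_sub_lt_iff.2 ⟨sub_lt_iff_lt_add'.2 (hys.trans_lt hsu), ?_⟩
            exact sub_lt_comm.1 ((sub_lt_sub_left hδδ u).trans h5)
        refine ⟨min t1 (u - max p (u - δ')), lt_min ht1 (sub_pos.2 hlt'), ?_⟩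
        intro y y' hy hy' hyy
        rcases key y hy with h1 | rfl
        · rcases key y' hy' with h2 | rfl
          · exact (add_le_add_right (min_le_left _ _) y).trans
              (hs1 y y' ⟨hy.1, h1⟩ ⟨hy'.1, h2⟩ hyy)
          · calc y + min t1 (y' - max p (y' - δ')) ≤ max p (y' - δ') + (y' - max p (y' - δ')) :=
                add_le_add h1 (min_le_right _ _)
              _ = y' := by abel
        · rcases key y' hy' with h2 | rfl
          · exact absurd (hyy.trans_le h2) (not_lt.2 hlt'.le)
          · exact absurd hyy (lt_irrefl _)) q hpq le_rfl
  obtain ⟨t, ht, hs⟩ := this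
  exact ⟨t, ht, fun y y' hy hy' => hs y y' ⟨hy, (hb y hy).2⟩ ⟨hy', (hb y' hy').2⟩⟩

theorem lds_of_closed [GS L R] {C : R → Prop} (hdef : Dfn L (fun v : Unit → R => C (v ())))
    (hcl : IsClosed {y | C y}) (hint : ∀ p q, p < q → ∃ w, p < w ∧ w < q ∧ ¬ C w) : LDs C := by
  intro a
  obtain ⟨N, δ, hδ, h⟩ := sep_bound (L := L) (ι := Empty)
    (Z := fun _ t y => C y ∧ ∀ y', y < y' → y' < y + t → ¬ C y') (by
      refine Dfn.and (Dfn.reindex hdef (fun _ => Sum.inr 1)) (Dfn.all (Dfn.imp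
        (Dfn.lt (DFn.var _) (DFn.var _)) (Dfn.imp (Dfn.lt (DFn.var _) (DFn.add (DFn.var _) (DFn.var _)))
          (Dfn.not (Dfn.reindex hdef (fun _ => Sum.inr ()))))))) a (fun k => k.elim)
  let E : Set R := {y | (∃ t, 0 < t ∧ C y ∧ ∀ y', y < y' → y' < y + t → ¬ C y') ∧ |y - a| < δ}
  have hE : E.Finite := by
    refine finite_of_bound (N := N) fun F hF => ?_
    have h1 : ∀ y ∈ F, ∀ᶠ t in 𝓝[>] (0 : R), C y ∧ ∀ y', y < y' → y' < y + t → ¬ C y' := by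
      intro y hy
      obtain ⟨⟨t, ht, hC, hh⟩, -⟩ := hF y hy
      exact ev_of_exists (fun s t _ hst ⟨h1, h2⟩ => ⟨h1, fun y' h3 h4 => h2 y' h3
        (h4.trans_le (add_le_add_right hst y))⟩) ht ⟨hC, hh⟩
    have h2 : ∀ᶠ t in 𝓝[>] (0 : R), t < δ := mem_nhdsWithin_of_mem_nhds (Iio_mem_nhds hδ)
    obtain ⟨t, ht, h3, h4⟩ := exists_of_ev (((Filter.eventually_all_finset F).2 h1).and h2)
    refine h (fun k => k.elim) t (fun k => k.elim) ht h4 ?_ F (fun y hy => ⟨h3 y hy, (hF y hy).2⟩)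
    rintro y y' ⟨h5, h6⟩ ⟨h7, h8⟩ hyy
    by_contra hlt
    exact h6 y' hyy (not_le.1 hlt) h7
  obtain ⟨δ1, hδ1, h1⟩ := lds_of_finite hE a
  have hbet : ∀ y y', C y → C y' → y < y' → |y - a| < min δ δ1 → |y' - a| < min δ δ1 →
      y ≤ a ∧ a < y' := by
    intro y y' hy hy' hyy hya hya'
    obtain ⟨w, hyw, hwy, hw⟩ := hint y y' hyy
    obtain ⟨e, he⟩ := dc_sup (L := L) (S := fun z => C z ∧ z ≤ w)
      (hdef.and (Dfn.le (DFn.var _) (DFn.const _))) ⟨y, hy, hyw.le⟩ ⟨w, fun x hx => hx.2⟩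
    have heC : C e := by
      have := he.mem_closure ⟨y, hy, hyw.le⟩
      exact hcl.closure_subset_iff.2 (fun z hz => hz.1) this
    have hew : e ≤ w := he.2 fun z hz => hz.2
    have hew' : e < w := lt_of_le_of_ne hew (fun h => hw (h ▸ heC))
    have hye : y ≤ e := he.1 ⟨hy, hyw.le⟩
    have hea : |e - a| < min δ δ1 := by
      rw [abs_sub_lt_iff] at hya hya' ⊢
      exact ⟨(sub_le_sub_right (hew.trans hwy.le) a).trans_lt hya'.1,
        (sub_le_sub_left hye a).trans_lt hya.2⟩
    have : e = a := h1 e ⟨⟨w - e, sub_pos.2 hew', heC, fun z hz1 hz2 hz3 => by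
      rw [add_sub_cancel] at hz2
      exact absurd (he.1 ⟨hz3, hz2.le⟩) (not_le.2 hz1)⟩, hea.trans_le (min_le_left _ _)⟩
      (hea.trans_le (min_le_right _ _))
    rw [← this]
    exact ⟨hye, hew'.trans hwy⟩
  have hfin : {y | C y ∧ |y - a| < min δ δ1}.Finite := by
    have hA : {y | (C y ∧ |y - a| < min δ δ1) ∧ y ≤ a}.Subsingleton := by
      rintro y ⟨hy, hya⟩ y' ⟨hy', hya'⟩
      rcases lt_trichotomy y y' with hlt | h | hlt
      · exact absurd (hbet y y' hy.1 hy'.1 hlt hy.2 hy'.2).2 (not_lt.2 hya')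
      · exact h
      · exact absurd (hbet y' y hy'.1 hy.1 hlt hy'.2 hy.2).2 (not_lt.2 hya)
    have hB : {y | (C y ∧ |y - a| < min δ δ1) ∧ a < y}.Subsingleton := by
      rintro y ⟨hy, hya⟩ y' ⟨hy', hya'⟩
      rcases lt_trichotomy y y' with hlt | h | hlt
      · exact absurd (hbet y y' hy.1 hy'.1 hlt hy.2 hy'.2).1 (not_le.2 hya)
      · exact h
      · exact absurd (hbet y' y hy'.1 hy.1 hlt hy'.2 hy.2).1 (not_le.2 hya')
    refine (hA.finite.union hB.finite).subset fun y hy => ?_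
    rcases le_or_gt y a with h | h
    · exact Or.inl ⟨hy, h⟩
    · exact Or.inr ⟨hy, h⟩
  obtain ⟨δ2, hδ2, h2⟩ := lds_of_finite hfin a
  exact ⟨min (min δ δ1) δ2, lt_min (lt_min hδ hδ1) hδ2, fun y hy hya =>
    h2 y ⟨hy, hya.trans_le (min_le_left _ _)⟩ (hya.trans_le (min_le_right _ _))⟩

theorem dsigma_bound [GS L R] {C : (ι → R) → R → R → R → Prop} (hC : Dfn3 L C) {p q : R}
    (hb : ∀ x r s y, C x r s y → p ≤ y ∧ y ≤ q)
    (hpos : ∀ x r s y, C x r s y → 0 < r ∧ 0 < s)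
    (hcl : ∀ x r s, IsClosed {y | C x r s y})
    (hr : ∀ x r r' s y, r ≤ r' → C x r s y → C x r' s y)
    (hs : ∀ x r s s' y, 0 < s → s ≤ s' → C x r s' y → C x r s y) (a : R) (b : ι → R) :
    ∃ N : ℕ, ∃ δ : R, 0 < δ ∧ ∀ x, Nr δ b x →
      (∀ r s p q, p < q → ∃ w, p < w ∧ w < q ∧ ¬ C x r s w) →
      ∀ F : Finset R, (∀ y ∈ F, (∃ r s, C x r s y) ∧ |y - a| < δ) → F.card ≤ N := by
  obtain ⟨N, δ, hδ, h⟩ := chain_bound (L := L) (C := fun x r y => ∃ s, C x r s y)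
    (Dfn.ex (Dfn3.app hC (fun i => DFn.var _) (DFn.var _) (DFn.var _) (DFn.var _)))
    (by
      intro x r r'
      rcases le_total r r' with h | h
      · exact Or.inl fun y ⟨s, hy⟩ => ⟨s, hr _ _ _ _ _ h hy⟩
      · exact Or.inr fun y ⟨s, hy⟩ => ⟨s, hr _ _ _ _ _ h hy⟩) a b
  refine ⟨N, δ, hδ, fun x hx hint => h x hx fun r => ?_⟩
  refine sep_of_lds (L := L) (p := p) (q := q)
    (Dfn.ex (Dfn3.app hC (fun i => DFn.const _) (DFn.const _) (DFn.var _) (DFn.var _))) ?_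
    (fun y ⟨s, hy⟩ => hb _ _ _ _ hy)
  refine lds_of_bound fun a' => ?_
  obtain ⟨N', δ', hδ', h'⟩ := chain_bound (L := L) (ι := Empty) (C := fun _ s y => C x r s y)
    (Dfn3.app hC (fun i => DFn.const _) (DFn.const _) (DFn.var _) (DFn.var _))
    (by
      intro _ s s'
      rcases le_total s s' with h | h
      · by_cases h0 : 0 < s
        · exact Or.inr fun y hy => hs _ _ _ _ _ h0 h hy
        · exact Or.inl fun y hy => absurd (hpos _ _ _ _ hy).2 h0
      · by_cases h0 : 0 < s'
        · exact Or.inl fun y hy => hs _ _ _ _ _ h0 h hy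
        · exact Or.inr fun y hy => absurd (hpos _ _ _ _ hy).2 h0) a' (fun k => k.elim)
  refine ⟨N', δ', hδ', h' (fun k => k.elim) (fun k => k.elim) fun s => ?_⟩
  have hd : Dfn L (fun v : Unit → R => C x r s (v ())) :=
    Dfn3.app hC (fun i => DFn.const _) (DFn.const _) (DFn.const _) (DFn.var _)
  exact sep_of_lds (L := L) (p := p) (q := q) hd (lds_of_closed hd (hcl x r s) (hint r s))
    (fun y hy => hb _ _ _ _ hy)

end OneDim

section DSSec

variable {L : FirstOrder.Language} {R : Type*} [L.Structure R] [AddCommGroup R] [LinearOrder R]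
  [IsOrderedAddMonoid R] [DenselyOrdered R] [Nontrivial R] [TopologicalSpace R] [OrderTopology R]
  {ι κ : Type}

/-- Families of closed bounded definable sets, monotone in both parameters. -/
structure DS (L : FirstOrder.Language) {R : Type*} [L.Structure R] [AddCommGroup R] [LinearOrder R]
    [TopologicalSpace R] {ι : Type} (F : R → R → (ι → R) → Prop) : Prop where
  dfn : Dfn2 L (fun x r s => F r s x)
  pos : ∀ r s x, F r s x → 0 < r ∧ 0 < s
  cl : ∀ r s, IsClosed {x | F r s x}
  bd : ∀ r s, ∃ c e, ∀ x, F r s x → ∀ i, c ≤ x i ∧ x i ≤ e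
  mr : ∀ r r' s x, r ≤ r' → F r s x → F r' s x
  ms : ∀ r s s' x, 0 < s → s ≤ s' → F r s' x → F r s x

/-- The union of a family. -/
def Un (F : R → R → (ι → R) → Prop) (x : ι → R) : Prop := ∃ r s, F r s x

theorem DS.app [Finite ι] {F : R → R → (ι → R) → Prop} (h : DS L F) {x : (κ → R) → ι → R}
    {r s : (κ → R) → R} (hr : DFn L r) (hs : DFn L s) (hx : ∀ i, DFn L (fun v => x v i)) :
    Dfn L (fun v => F (r v) (s v) (x v)) := Dfn2.app h.dfn hx hr hs

theorem DS.proj [GS L R] [Finite ι] [Finite κ] {P : R → R → (ι → R) → (κ → R) → Prop}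
    (h : DS L (fun r s (u : ι ⊕ κ → R) => P r s (fun i => u (Sum.inl i)) (fun k => u (Sum.inr k)))) :
    DS L (fun r s v => ∃ w, P r s v w) where
  dfn := by
    refine Dfn.exs ?_
    have := DS.app h (κ := (ι ⊕ Fin 2) ⊕ κ) (r := fun v => v (Sum.inl (Sum.inr 0)))
      (s := fun v => v (Sum.inl (Sum.inr 1)))
      (x := fun v k => Sum.elim (fun i => v (Sum.inl (Sum.inl i))) (fun k => v (Sum.inr k)) k)
      (DFn.var _) (DFn.var _) (fun k => by rcases k with k | k <;> exact DFn.var _)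
    exact this
  pos := fun r s v ⟨w, hw⟩ => h.pos r s (Sum.elim v w) hw
  cl := fun r s => by
    obtain ⟨c, e, hb⟩ := h.bd r s
    refine proj_closed (L := L) (P := P r s) (c := c) (e := e) ?_ ?_ ?_
    · exact DS.app h (DFn.const r) (DFn.const s) (fun k => DFn.var k)
    · exact (h.cl r s).preimage (f := fun p : (ι → R) × (κ → R) => Sum.elim p.1 p.2) (by
          refine continuous_pi fun k => ?_
          cases k
          · exact (continuous_apply _).comp continuous_fst
          · exact (continuous_apply _).comp continuous_snd)
    · intro v w hP k
      exact hb (Sum.elim v w) hP (Sum.inr k)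
  bd := fun r s => by
    obtain ⟨c, e, hb⟩ := h.bd r s
    exact ⟨c, e, fun v ⟨w, hw⟩ i => hb (Sum.elim v w) hw (Sum.inl i)⟩
  mr := fun r r' s v hr ⟨w, hw⟩ => ⟨w, h.mr r r' s (Sum.elim v w) hr hw⟩
  ms := fun r s s' v h0 hr ⟨w, hw⟩ => ⟨w, h.ms r s s' (Sum.elim v w) h0 hr hw⟩

/-- Intersection with a closed definable set. -/
theorem DS.inter [GS L R] {F : R → R → (ι → R) → Prop} (h : DS L F) {Q : (ι → R) → Prop}
    (hQ : Dfn L Q) (hcl : IsClosed {x | Q x}) : DS L (fun r s x => F r s x ∧ Q x) where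
  dfn := Dfn.and h.dfn (Dfn.reindex hQ _)
  pos := fun r s x hx => h.pos r s x hx.1
  cl := fun r s => (h.cl r s).inter hcl
  bd := fun r s => by
    obtain ⟨c, e, hb⟩ := h.bd r s
    exact ⟨c, e, fun x hx => hb x hx.1⟩
  mr := fun r r' s x hr hx => ⟨h.mr r r' s x hr hx.1, hx.2⟩
  ms := fun r s s' x h0 hr hx => ⟨h.ms r s s' x h0 hr hx.1, hx.2⟩

theorem DS.ball [GS L R] [Finite ι] {F : R → R → (ι → R) → Prop} (h : DS L F) (x0 : ι → R) (δ : R) :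
    DS L (fun r s x => F r s x ∧ ∀ i, |x i - x0 i| ≤ δ) :=
  h.inter (Dfn.finAll fun i => Dfn.absLe (DFn.sub (DFn.var _) (DFn.const _)) (DFn.const _))
    (isClosed_nr δ x0)

/-- Prepend a coordinate. -/
def oc (u : R) (z : ι → R) : Option ι → R := fun o => o.elim u z

theorem oc_eta (x : Option ι → R) : oc (x none) (fun i => x (some i)) = x := by
  ext o; cases o <;> rfl

theorem continuous_oc : Continuous (fun p : R × (ι → R) => oc p.1 p.2) := by
  refine continuous_pi fun o => ?_
  rcases o with _ | i
  · exact continuous_fst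
  · show Continuous (fun p : R × (ι → R) => p.2 i)
    fun_prop

/-- The family of intervals in fibres. -/
def WF (F : R → R → (Option ι → R) → Prop) (p q : R) (r s : R) (z : ι → R) (u : R) : Prop :=
  0 < r ∧ 0 < s ∧ p ≤ u ∧ u + s ≤ q ∧ ∀ t, 0 ≤ t → t ≤ s → F r s (oc (u + t) z)

theorem WF.ds [GS L R] [Finite ι] {F : R → R → (Option ι → R) → Prop} (h : DS L F) (p q : R) :
    DS L (fun r s (x : ι ⊕ Unit → R) =>
      WF F p q r s (fun i => x (Sum.inl i)) (x (Sum.inr ()))) where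
  dfn := by
    unfold WF
    refine Dfn.and (Dfn.lt (DFn.const _) (DFn.var _)) (Dfn.and (Dfn.lt (DFn.const _) (DFn.var _))
      (Dfn.and (Dfn.le (DFn.const _) (DFn.var _)) (Dfn.and (Dfn.le (DFn.add (DFn.var _)
        (DFn.var _)) (DFn.const _)) (Dfn.all (Dfn.imp (Dfn.le (DFn.const _) (DFn.var _))
          (Dfn.imp (Dfn.le (DFn.var _) (DFn.var _)) ?_))))))
    refine DS.app h (DFn.var _) (DFn.var _) fun o => ?_
    cases o
    · exact DFn.add (DFn.var _) (DFn.var _)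
    · exact DFn.var _
  pos := fun r s x hx => ⟨hx.1, hx.2.1⟩
  cl := fun r s => by
    have : {x : ι ⊕ Unit → R | WF F p q r s (fun i => x (Sum.inl i)) (x (Sum.inr ()))} =
      {x | 0 < r ∧ 0 < s} ∩ ({x | p ≤ x (Sum.inr ())} ∩ ({x | x (Sum.inr ()) + s ≤ q} ∩
        ⋂ t, {x | 0 ≤ t ∧ t ≤ s → F r s (oc (x (Sum.inr ()) + t) (fun i => x (Sum.inl i)))})) := by
      ext x
      simp only [WF, mem_ofPred_eq, mem_inter_iff, mem_iInter, and_imp, and_assoc]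
    rw [this]
    refine isClosed_const.inter ((isClosed_le continuous_const (by fun_prop)).inter
      ((isClosed_le (by fun_prop) continuous_const).inter (isClosed_iInter fun t => ?_)))
    by_cases ht : 0 ≤ t ∧ t ≤ s
    · simp only [ht, and_self, forall_const]
      exact (h.cl r s).preimage (f := fun x : ι ⊕ Unit → R =>
        oc (x (Sum.inr ()) + t) (fun i => x (Sum.inl i)))
        (continuous_oc.comp (Continuous.prodMk (by fun_prop) (by fun_prop)))
    · simp only [ht, false_imp_iff]
      exact isClosed_univ
  bd := fun r s => by
    obtain ⟨c, e, hb⟩ := h.bd r s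
    refine ⟨min c p, max e q, fun x hx i => ?_⟩
    obtain ⟨h1, h2, h3, h4, h5⟩ := hx
    rcases i with i | i
    · have := hb _ (h5 0 le_rfl h2.le) (some i)
      exact ⟨(min_le_left _ _).trans this.1, this.2.trans (le_max_left _ _)⟩
    · exact ⟨(min_le_right _ _).trans h3, ((le_add_of_nonneg_right h2.le).trans h4).trans
        (le_max_right _ _)⟩
  mr := fun r r' s x hr ⟨h1, h2, h3, h4, h5⟩ => ⟨h1.trans_le hr, h2, h3, h4, fun t ht ht' =>
    h.mr _ _ _ _ hr (h5 t ht ht')⟩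
  ms := fun r s s' x h0 hr ⟨h1, h2, h3, h4, h5⟩ => ⟨h1, h0, h3,
    (add_le_add_right hr _).trans h4, fun t ht ht' => h.ms _ _ _ _ h0 hr (h5 t ht (ht'.trans hr))⟩

/-- Points whose fibres contain an interval. -/
def WU (F : R → R → (Option ι → R) → Prop) (p q : R) (r s : R) (z : ι → R) : Prop :=
  ∃ u, WF F p q r s z u

theorem WU.ds [GS L R] [Finite ι] {F : R → R → (Option ι → R) → Prop} (h : DS L F) (p q : R) :
    DS L (WU F p q) := by
  have := DS.proj (L := L) (ι := ι) (κ := Unit) (P := fun r s z w => WF F p q r s z (w ()))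
    (WF.ds h p q)
  have he : (fun (r s : R) (v : ι → R) => ∃ w : Unit → R, WF F p q r s v (w ())) = WU F p q := by
    funext r s v
    exact propext ⟨fun ⟨w, hw⟩ => ⟨_, hw⟩, fun ⟨w, hw⟩ => ⟨fun _ => w, hw⟩⟩
  rwa [he] at this

theorem not_interval_of_not_WU {F : R → R → (Option ι → R) → Prop} (h : DS L F) {p q : R}
    {z : ι → R} (hz : ¬ Un (WU F p q) z) (r s p' q' : R) (hpq : p' < q') :
    ∃ w, p' < w ∧ w < q' ∧ ¬ (F r s (oc w z) ∧ p ≤ w ∧ w ≤ q) := by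
  by_contra hcon
  push Not at hcon
  obtain ⟨u, hu1, hu2⟩ := exists_between hpq
  obtain ⟨u1, hu3, hu4⟩ := exists_between hu2
  obtain ⟨h1, h2, h3⟩ := hcon u hu1 hu2
  obtain ⟨h4, h5, h6⟩ := hcon u1 (hu1.trans hu3) hu4
  obtain ⟨hr, hs⟩ := h.pos _ _ _ h1
  have hs0 : 0 < min s (u1 - u) := lt_min hs (sub_pos.2 hu3)
  have hle : u + min s (u1 - u) ≤ u1 := by
    rw [← le_sub_iff_add_le']; exact min_le_right _ _
  refine hz ⟨r, min s (u1 - u), u, hr, hs0, h2, hle.trans h6, fun t ht0 ht => ?_⟩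
  refine h.ms _ _ s _ hs0 (min_le_left _ _) (hcon (u + t) ?_ ?_).1
  · exact hu1.trans_le (le_add_of_nonneg_right ht0)
  · exact ((add_le_add_right ht u).trans hle).trans_lt hu4

theorem WU.interior [GS L R] [Finite ι] {F : R → R → (Option ι → R) → Prop} (h : DS L F) {p q r s : R}
    {O : Set (ι → R)} (hO : IsOpen O) (hne : O.Nonempty) (hsub : ∀ z ∈ O, WU F p q r s z) :
    ∃ O' : Set (Option ι → R), IsOpen O' ∧ O'.Nonempty ∧ ∀ x ∈ O', F r s x := by
  obtain ⟨z, hz⟩ := hne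
  obtain ⟨δ, hδ, hball⟩ := exists_nr hO hz
  obtain ⟨-, -, hs, -⟩ := hsub z hz
  have hd : Dfn L (fun w : ι ⊕ Unit → R => WF F p q r s (fun i => w (Sum.inl i)) (w (Sum.inr ()))) :=
    DS.app (WF.ds h p q) (DFn.const r) (DFn.const s) (fun k => DFn.var k)
  obtain ⟨τ, hτ⟩ := dc_inf (L := L)
    (S := fun τ => ∃ z : ι → R, ∃ δ, 0 < δ ∧ ∀ z', Nr δ z z' → ∃ u, u ≤ τ ∧ WF F p q r s z' u)
    (by
      refine Dfn.exs (Dfn.ex (Dfn.and (Dfn.lt (DFn.const _) (DFn.var _)) (Dfn.alls (Dfn.imp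
        (Dfn.nr (DFn.var _) (fun _ => DFn.var _) (fun _ => DFn.var _)) (Dfn.ex (Dfn.and
          (Dfn.le (DFn.var _) (DFn.var _)) ?_))))))
      exact Dfn.reindex hd (fun k => match k with
        | Sum.inl i => Sum.inl (Sum.inr i)
        | Sum.inr _ => Sum.inr ()))
    ⟨q, z, δ, hδ, fun z' hz' => by
      obtain ⟨u, hu⟩ := hsub z' (hball z' hz')
      exact ⟨u, (le_add_of_nonneg_right hs.le).trans hu.2.2.2.1, hu⟩⟩
    ⟨p, fun τ ⟨z, δ, hδ, hh⟩ => by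
      obtain ⟨u, hu, hu'⟩ := hh z (Nr.refl hδ z)
      exact hu'.2.2.1.trans hu⟩
  obtain ⟨s1, hs1, hs1s⟩ := exists_half hs
  obtain ⟨τ0, ⟨z0, δ0, hδ0, h0⟩, hτ0⟩ := (isGLB_lt_iff hτ).1 (lt_add_of_pos_right τ hs1)
  have hA : IsClosed {z | ∃ u, u ≤ τ - s1 ∧ WF F p q r s z u} := by
    refine proj_closed1 (L := L) (P := fun z u => u ≤ τ - s1 ∧ WF F p q r s z u) (c := p) (e := q)
      (Dfn.and (Dfn.le (DFn.var _) (DFn.const _)) hd) ?_ ?_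
    · refine IsClosed.inter (isClosed_le continuous_snd continuous_const) ?_
      exact ((WF.ds h p q).cl r s).preimage (f := fun p : (ι → R) × R => Sum.elim p.1 (fun _ => p.2))
        (by
          refine continuous_pi fun k => ?_
          cases k
          · exact (continuous_apply _).comp continuous_fst
          · exact continuous_snd)
    · rintro v y ⟨h1, h2⟩
      exact ⟨h2.2.2.1, (le_add_of_nonneg_right hs.le).trans h2.2.2.2.1⟩
  have hz1 : ∃ z1, Nr δ0 z0 z1 ∧ ¬ ∃ u, u ≤ τ - s1 ∧ WF F p q r s z1 u := by
    by_contra hcon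
    push Not at hcon
    have : τ ≤ τ - s1 := hτ.1 ⟨z0, δ0, hδ0, hcon⟩
    exact absurd this (not_le.2 (sub_lt_self _ hs1))
  obtain ⟨z1, hz1, hz1'⟩ := hz1
  have hlt : τ + s1 < τ - s1 + s := by
    rw [← sub_pos]
    have : τ - s1 + s - (τ + s1) = s - (s1 + s1) := by abel
    rw [this]; exact sub_pos.2 hs1s
  refine ⟨{x | (Nr δ0 z0 (fun i => x (some i)) ∧ ¬ ∃ u, u ≤ τ - s1 ∧ WF F p q r s (fun i => x (some i)) u)
    ∧ τ + s1 < x none ∧ x none < τ - s1 + s}, ?_, ?_, ?_⟩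
  · refine IsOpen.inter (IsOpen.inter ?_ ?_) (IsOpen.inter ?_ ?_)
    · exact (isOpen_nr δ0 z0).preimage (f := fun (x : Option ι → R) i => x (some i)) (by fun_prop)
    · exact hA.isOpen_compl.preimage (f := fun (x : Option ι → R) i => x (some i)) (by fun_prop)
    · exact isOpen_lt continuous_const (by fun_prop)
    · exact isOpen_lt (by fun_prop) continuous_const
  · obtain ⟨y, hy1, hy2⟩ := exists_between hlt
    exact ⟨oc y z1, ⟨hz1, hz1'⟩, hy1, hy2⟩
  · rintro x ⟨⟨hx1, hx2⟩, hx3, hx4⟩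
    obtain ⟨u, hu, hu'⟩ := h0 _ hx1
    have hu2 : τ - s1 < u := by
      by_contra hle
      exact hx2 ⟨u, not_lt.1 hle, hu'⟩
    have := hu'.2.2.2.2 (x none - u) (sub_nonneg.2 ((hu.trans hτ0.le).trans hx3.le)) (by
      rw [sub_le_iff_le_add']
      exact hx4.le.trans (add_le_add_left hu2.le s))
    rw [add_sub_cancel, oc_eta] at this
    exact this

theorem fib_bound [GS L R] [Finite ι] {F : R → R → (Option ι → R) → Prop} (h : DS L F) (p q a : R)
    (b : ι → R) :
    ∃ N : ℕ, ∃ δ : R, 0 < δ ∧ ∀ z, Nr δ b z → ¬ Un (WU F p q) z →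
      ∀ S : Finset R, (∀ y ∈ S, Un F (oc y z) ∧ p ≤ y ∧ y ≤ q ∧ |y - a| < δ) → S.card ≤ N := by
  obtain ⟨N, δ, hδ, hh⟩ := dsigma_bound (L := L)
    (C := fun z r s y => F r s (oc y z) ∧ p ≤ y ∧ y ≤ q) (p := p) (q := q)
    (by
      refine Dfn.and (DS.app h (DFn.var _) (DFn.var _) fun o => ?_)
        (Dfn.and (Dfn.le (DFn.const _) (DFn.var _)) (Dfn.le (DFn.var _) (DFn.const _)))
      cases o <;> exact DFn.var _)
    (fun x r s y hy => hy.2) (fun x r s y hy => h.pos _ _ _ hy.1)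
    (fun x r s => by
      refine IsClosed.inter ?_ isClosed_Icc
      exact (h.cl r s).preimage (f := fun y => oc y x)
        (continuous_oc.comp (Continuous.prodMk (by fun_prop) (by fun_prop))))
    (fun x r r' s y hr hy => ⟨h.mr _ _ _ _ hr hy.1, hy.2⟩)
    (fun x r s s' y h0 hr hy => ⟨h.ms _ _ _ _ h0 hr hy.1, hy.2⟩) a b
  refine ⟨N, δ, hδ, fun z hz hnz S hS => hh z hz ?_ S fun y hy => ?_⟩
  · exact not_interval_of_not_WU h hnz
  · obtain ⟨⟨r, s, h1⟩, h2, h3, h4⟩ := hS y hy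
    exact ⟨⟨r, s, h1, h2, h3⟩, h4⟩

theorem DS.equiv {F : R → R → (ι → R) → Prop} (h : DS L F) (e : ι ≃ κ) :
    DS L (fun r s (x : κ → R) => F r s (fun i => x (e i))) where
  dfn := Dfn.reindex h.dfn (ι := κ ⊕ Fin 2) (Sum.map e id)
  pos := fun r s x hx => h.pos r s _ hx
  cl := fun r s => (h.cl r s).preimage (f := fun (x : κ → R) i => x (e i)) (by fun_prop)
  bd := fun r s => by
    obtain ⟨c, d, hb⟩ := h.bd r s
    exact ⟨c, d, fun x hx k => by simpa using hb _ hx (e.symm k)⟩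
  mr := fun r r' s x hr hx => h.mr r r' s _ hr hx
  ms := fun r s s' x h0 hr hx => h.ms r s s' _ h0 hr hx

theorem baire0 [GS L R] [Finite ι] : ∀ {F : R → R → (ι → R) → Prop} (h : DS L F) {O : Set (ι → R)}
    (hO : IsOpen O) (hne : O.Nonempty) (hsub : ∀ x ∈ O, Un F x),
    ∃ O' : Set (ι → R), ∃ r s, IsOpen O' ∧ O'.Nonempty ∧ ∀ x ∈ O', F r s x := by
  refine Finite.induction_empty_option (P := fun ι : Type => ∀ {F : R → R → (ι → R) → Prop}
    (h : DS L F) {O : Set (ι → R)}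
    (hO : IsOpen O) (hne : O.Nonempty) (hsub : ∀ x ∈ O, Un F x),
    ∃ O' : Set (ι → R), ∃ r s, IsOpen O' ∧ O'.Nonempty ∧ ∀ x ∈ O', F r s x) ?_ ?_ ?_ ι
  · intro α β e ih F h O hO ⟨x, hx⟩ hsub
    obtain ⟨O', r, s, h1, ⟨y, hy⟩, h3⟩ := ih (h.equiv e.symm)
      (O := (fun (x : α → R) b => x (e.symm b)) ⁻¹' O) (hO.preimage (by fun_prop))
      ⟨fun a => x (e a), by simpa using hx⟩ (fun x hx => hsub _ hx)
    refine ⟨(fun (x : β → R) a => x (e a)) ⁻¹' O', r, s, h1.preimage (by fun_prop),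
      ⟨fun b => y (e.symm b), by simpa using hy⟩, fun x hx => ?_⟩
    simpa using h3 _ hx
  · intro F h O hO ⟨x, hx⟩ hsub
    obtain ⟨r, s, hrs⟩ := hsub x hx
    exact ⟨univ, r, s, isOpen_univ, ⟨x, mem_univ _⟩, fun y _ => by
      have : y = x := funext fun k => k.elim
      exact this ▸ hrs⟩
  · intro ι _ ih F h O hO ⟨x0, hx0⟩ hsub
    obtain ⟨δ, hδ, hball⟩ := exists_nr hO hx0
    obtain ⟨δ', hδ', hδδ⟩ := exists_between hδ
    have key : ∀ z : ι → R, Nr δ (fun i => x0 (some i)) z →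
        Un (WU F (x0 none) (x0 none + δ')) z := by
      intro z hz
      by_contra hnot
      obtain ⟨N, δ1, hδ1, hN⟩ := fib_bound h (x0 none) (x0 none + δ') (x0 none) z
      have hinf : (Ioo (x0 none) (x0 none + min δ' δ1)).Infinite :=
        Ioo_infinite (lt_add_of_pos_right _ (lt_min hδ' hδ1))
      obtain ⟨S, hS, hc⟩ := hinf.exists_subset_card_eq (N + 1)
      have := hN z (Nr.refl hδ1 z) hnot S (fun y hy => by
        obtain ⟨h1, h2⟩ := hS hy
        have h3 : |y - x0 none| < min δ' δ1 := by
          rw [abs_of_pos (sub_pos.2 h1)]; exact sub_lt_iff_lt_add'.2 h2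
        refine ⟨hsub _ (hball _ ?_), h1.le, h2.le.trans (add_le_add_right (min_le_left _ _) _),
          h3.trans_le (min_le_right _ _)⟩
        intro o
        cases o
        · exact (h3.trans_le (min_le_left _ _)).trans hδδ
        · exact hz _)
      omega
    obtain ⟨O', r, s, h1, h2, h3⟩ := ih (WU.ds h (x0 none) (x0 none + δ'))
      (isOpen_nr δ (fun i => x0 (some i))) ⟨_, Nr.refl hδ _⟩ key
    obtain ⟨O2, h4, h5, h6⟩ := WU.interior h h1 h2 h3
    exact ⟨O2, r, s, h4, h5, h6⟩

theorem baire [GS L R] [Finite ι] {F : R → R → (ι → R) → Prop} (h : DS L F) {O : Set (ι → R)}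
    (hO : IsOpen O) (hne : O.Nonempty) (hsub : ∀ x ∈ O, Un F x) :
    ∃ O' : Set (ι → R), ∃ r s, IsOpen O' ∧ O'.Nonempty ∧ O' ⊆ O ∧ ∀ x ∈ O', F r s x := by
  obtain ⟨x0, hx0⟩ := hne
  obtain ⟨δ, hδ, hball⟩ := exists_nr hO hx0
  obtain ⟨δ', hδ', hδδ⟩ := exists_between hδ
  obtain ⟨O', r, s, h1, h2, h3⟩ := baire0 (h.ball x0 δ') (isOpen_nr δ' x0) ⟨x0, Nr.refl hδ' x0⟩
    (fun x hx => by
      obtain ⟨r, s, hrs⟩ := hsub x (hball x (Nr.mono hδδ.le hx))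
      exact ⟨r, s, hrs, fun i => (hx i).le⟩)
  exact ⟨O', r, s, h1, h2, fun x hx => hball x fun i => ((h3 x hx).2 i).trans_lt hδδ,
    fun x hx => (h3 x hx).1⟩

end DSSec

section NDSec

theorem cons_dich {α : Type*} [TopologicalSpace α] {S : Set α} (hS : IsConstructibleSet S) :
    ∀ O : Set α, IsOpen O → O.Nonempty →
      ∃ O' : Set α, IsOpen O' ∧ O'.Nonempty ∧ O' ⊆ O ∧ (O' ⊆ S ∨ O' ⊆ Sᶜ) := by
  induction hS with
  | of_isOpen s hs =>
    intro O hO hne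
    by_cases h : (O ∩ s).Nonempty
    · exact ⟨O ∩ s, hO.inter hs, h, inter_subset_left, Or.inl inter_subset_right⟩
    · exact ⟨O, hO, hne, Subset.refl _, Or.inr fun x hx hxs => h ⟨x, hx, hxs⟩⟩
  | compl s hs ih =>
    intro O hO hne
    obtain ⟨O', h1, h2, h3, h4⟩ := ih O hO hne
    refine ⟨O', h1, h2, h3, ?_⟩
    rw [compl_compl]
    exact h4.symm
  | union s t hs ht ih1 ih2 =>
    intro O hO hne
    obtain ⟨O', h1, h2, h3, h4⟩ := ih1 O hO hne
    rcases h4 with h4 | h4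
    · exact ⟨O', h1, h2, h3, Or.inl (h4.trans subset_union_left)⟩
    obtain ⟨O2, g1, g2, g3, g4⟩ := ih2 O' h1 h2
    rcases g4 with g4 | g4
    · exact ⟨O2, g1, g2, g3.trans h3, Or.inl (g4.trans subset_union_right)⟩
    · refine ⟨O2, g1, g2, g3.trans h3, Or.inr fun x hx hxs => ?_⟩
      rcases hxs with hxs | hxs
      · exact h4 (g3 hx) hxs
      · exact g4 hx hxs

variable {L : FirstOrder.Language} {R : Type*} [L.Structure R] [AddCommGroup R] [LinearOrder R]
  [IsOrderedAddMonoid R] [DenselyOrdered R] [Nontrivial R] [TopologicalSpace R] [OrderTopology R]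

theorem setDim_lt {n d : ℕ} {Y : Set (Fin n → R)}
    (h : ∀ x : Fin n → R, ∃ B : Set (Fin n → R), OpenBox B ∧ x ∈ B ∧ ∀ d', d ≤ d' →
      ∀ f : Fin d' → Fin n, Function.Injective f →
        ¬ (interior ((fun y => y ∘ f) '' (B ∩ Y))).Nonempty) :
    setDim Y < ((d : ℕ∞) : WithBot ℕ∞) := by
  have key : ∀ c : WithBot ℕ∞, (∀ d' : ℕ, d' < d → ((d' : ℕ∞) : WithBot ℕ∞) ≤ c) → setDim Y ≤ c := by
    intro c hc
    refine iSup_le fun x => sSup_le ?_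
    rintro _ ⟨d', rfl, hd'⟩
    refine hc d' ?_
    by_contra hle
    obtain ⟨B, hB, hxB, hh⟩ := h x
    obtain ⟨f, hf, hne⟩ := hd' B hB hxB
    exact hh d' (not_lt.1 hle) f hf hne
  rcases d with _ | d
  · refine (key ⊥ (fun d' hd' => by omega)).trans_lt ?_
    exact WithBot.bot_lt_coe _
  · refine (key ((d : ℕ∞) : WithBot ℕ∞) (fun d' hd' => ?_)).trans_lt ?_
    · exact_mod_cast Nat.lt_succ_iff.1 hd'
    · exact_mod_cast Nat.lt_succ_self d

theorem interior_reduce {n d d' : ℕ} (hd : d ≤ d') (f : Fin d' → Fin n) {A : Set (Fin n → R)}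
    (h : (interior ((fun y => y ∘ f) '' A)).Nonempty) :
    (interior ((fun y => y ∘ (f ∘ Fin.castLE hd)) '' A)).Nonempty := by
  obtain ⟨y0, hy0⟩ := h
  obtain ⟨δ, hδ, hb⟩ := exists_nr isOpen_interior hy0
  refine ⟨fun i => y0 (Fin.castLE hd i), ?_⟩
  refine mem_interior.2 ⟨{z | Nr δ (fun i => y0 (Fin.castLE hd i)) z}, fun z hz => ?_,
    isOpen_nr _ _, Nr.refl hδ _⟩
  have := interior_subset (hb (fun i => if h : (i : ℕ) < d then z ⟨i, h⟩ else y0 i) (by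
    intro i
    by_cases hi : (i : ℕ) < d
    · simp only [hi, dite_true]
      exact hz ⟨i, hi⟩
    · simpa [hi] using hδ))
  obtain ⟨w, hw, hwe⟩ := this
  refine ⟨w, hw, ?_⟩
  funext i
  have := congrFun hwe (Fin.castLE hd i)
  simpa using this

theorem DS.of_isDSigma [GS L R] {n : ℕ} {X : Set (Fin n → R)} (h : IsDSigma L X) :
    ∃ F : R → R → (Fin n → R) → Prop, DS L F ∧ ∀ x, x ∈ X ↔ Un F x := by
  obtain ⟨G, ⟨h1, h2, h3, h4⟩, rfl⟩ := h
  refine ⟨fun r s x => 0 < r ∧ 0 < s ∧ x ∈ famFiber G r s, ?_, ?_⟩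
  · refine ⟨?_, fun r s x hx => ⟨hx.1, hx.2.1⟩, ?_, ?_, ?_, ?_⟩
    · refine Dfn.and (Dfn.lt (DFn.const _) (DFn.var _)) (Dfn.and (Dfn.lt (DFn.const _) (DFn.var _)) ?_)
      have h5 : Dfn L (fun v => v ∈ G) := dfn_iff.1 h1
      refine Dfn.subst (t := fun (w : Fin n ⊕ Fin 2 → R) => Fin.append ![w (Sum.inr 0), w (Sum.inr 1)]
        (fun i => w (Sum.inl i))) h5 fun k => ?_
      refine Fin.addCases (fun i => ?_) (fun i => ?_) k
      · simp only [Fin.append_left]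
        fin_cases i <;> exact DFn.var _
      · simp only [Fin.append_right]
        exact DFn.var _
    · intro r s
      by_cases hp : 0 < r ∧ 0 < s
      · simp only [hp.1, hp.2, true_and]
        exact (h2 r s hp.1 hp.2).2.1
      · have : {x : Fin n → R | 0 < r ∧ 0 < s ∧ x ∈ famFiber G r s} = ∅ := by
          ext x
          simp only [mem_ofPred_eq, mem_empty_iff_false, iff_false]
          exact fun h => hp ⟨h.1, h.2.1⟩
        rw [this]; exact isClosed_empty
    · intro r s
      by_cases hp : 0 < r ∧ 0 < s
      · obtain ⟨c, e, hb⟩ := (h2 r s hp.1 hp.2).2.2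
        exact ⟨c, e, fun x hx => hb x hx.2.2⟩
      · exact ⟨0, 0, fun x hx => absurd ⟨hx.1, hx.2.1⟩ hp⟩
    · rintro r r' s x hr ⟨g1, g2, g3⟩
      exact ⟨g1.trans_le hr, g2, h3 r r' s g1 g2 hr g3⟩
    · rintro r s s' x h0 hs ⟨g1, g2, g3⟩
      exact ⟨g1, h0, h4 r s s' g1 h0 hs g3⟩
  · intro x
    simp only [mem_iUnion, Un, exists_prop]
    exact ⟨fun ⟨r, h1, s, h2, h3⟩ => ⟨r, s, h1, h2, h3⟩, fun ⟨r, s, h1, h2, h3⟩ => ⟨r, h1, s, h2, h3⟩⟩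

theorem DS.isDSigma [GS L R] {n : ℕ} {F : R → R → (Fin n → R) → Prop} (h : DS L F) :
    IsDSigma L {x | Un F x} := by
  have hfam : ∀ r s, famFiber {v : Fin (2 + n) → R | F (v (Fin.castAdd n 0)) (v (Fin.castAdd n 1))
      (fun i => v (Fin.natAdd 2 i))} r s = {x | F r s x} := by
    intro r s
    ext x
    simp only [famFiber, mem_ofPred_eq, Fin.append_left, Fin.append_right]
    rfl
  refine ⟨{v | F (v (Fin.castAdd n 0)) (v (Fin.castAdd n 1)) (fun i => v (Fin.natAdd 2 i))},
    ⟨?_, ?_, ?_, ?_⟩, ?_⟩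
  · exact dfn_iff.2 (DS.app h (DFn.var _) (DFn.var _) (fun i => DFn.var _))
  · intro r s hr hs
    rw [hfam]
    exact ⟨dfn_iff.2 (DS.app h (DFn.const _) (DFn.const _) (fun i => DFn.var _)), h.cl r s, h.bd r s⟩
  · intro r r' s hr hs hrr
    rw [hfam, hfam]
    exact fun x hx => h.mr _ _ _ _ hrr hx
  · intro r s s' hr hs hss
    rw [hfam, hfam]
    exact fun x hx => h.ms _ _ _ _ hs hss hx
  · ext x
    simp only [hfam, mem_iUnion, Un, exists_prop, mem_ofPred_eq]
    refine ⟨fun ⟨r, s, h3⟩ => ?_, fun ⟨r, h1, s, h2, h3⟩ => ⟨r, s, h3⟩⟩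
    exact ⟨r, (h.pos _ _ _ h3).1, s, (h.pos _ _ _ h3).2, h3⟩

theorem nd [GS L R] {d : ℕ} (hc : ∀ (m : ℕ) (Y : Set (Fin m → R)), IsDSigma L Y →
    setDim Y < ((d : ℕ∞) : WithBot ℕ∞) → IsConstructibleSet Y) {F : R → R → (Fin d → R) → Prop}
    (h : DS L F) {O : Set (Fin d → R)} (hO : IsOpen O) (hne : O.Nonempty) :
    ∃ O' : Set (Fin d → R), IsOpen O' ∧ O'.Nonempty ∧ O' ⊆ O ∧
      ((∀ x ∈ O', Un F x) ∨ (∀ x ∈ O', ¬ Un F x)) := by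
  by_cases hex : ∃ O' : Set (Fin d → R), IsOpen O' ∧ O'.Nonempty ∧ O' ⊆ O ∧ (∀ x ∈ O', Un F x)
  · obtain ⟨O', h1, h2, h3, h4⟩ := hex
    exact ⟨O', h1, h2, h3, Or.inl h4⟩
  obtain ⟨x0, hx0⟩ := hne
  obtain ⟨δ, hδ, hball⟩ := exists_nr hO hx0
  obtain ⟨δ', hδ', hδδ⟩ := exists_between hδ
  have hF := h.ball x0 δ'
  have hnot : ∀ V : Set (Fin d → R), IsOpen V → V.Nonempty →
      ¬ V ⊆ {x | Un (fun r s x => F r s x ∧ ∀ i, |x i - x0 i| ≤ δ') x} := by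
    intro V hV hVne hsub
    refine hex ⟨V, hV, hVne, fun x hx => ?_, fun x hx => ?_⟩
    · obtain ⟨r, s, h1, h2⟩ := hsub hx
      exact hball x fun i => (h2 i).trans_lt hδδ
    · obtain ⟨r, s, h1, h2⟩ := hsub hx
      exact ⟨r, s, h1⟩
  have hcon := hc d _ hF.isDSigma (setDim_lt fun x => by
    obtain ⟨c, e, hce, -⟩ := exists_inBox_subset isOpen_univ (mem_univ x)
    refine ⟨{x | InBox c e x}, ⟨c, e, rfl⟩, hce, fun d' hd' f hf hint => ?_⟩
    have hle : d' ≤ d := by simpa using Fintype.card_le_of_injective f hf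
    obtain rfl : d = d' := le_antisymm hd' hle
    obtain ⟨y0, hy0⟩ := hint
    have hbij : Function.Bijective f := Finite.injective_iff_bijective.1 hf
    obtain ⟨V, hV, hVo, hy0V⟩ := mem_interior.1 hy0
    let eq := Equiv.ofBijective f hbij
    refine hnot ((fun y : Fin d → R => y ∘ f) ⁻¹' V)
      (hVo.preimage (by fun_prop)) ⟨fun i => y0 (eq.symm i), ?_⟩ ?_
    · have : (fun i => y0 (eq.symm i)) ∘ f = y0 := by
        funext i
        exact congrArg y0 (eq.symm_apply_apply i)
      show (fun i => y0 (eq.symm i)) ∘ f ∈ V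
      rwa [this]
    · intro y hy
      obtain ⟨w, hw, hwy⟩ := hV hy
      have : w = y := by
        funext i
        obtain ⟨j, rfl⟩ := hbij.2 i
        exact congrFun hwy j
      exact this ▸ hw.2)
  obtain ⟨O', h1, h2, h3, h4⟩ := cons_dich hcon {x | Nr δ' x0 x} (isOpen_nr δ' x0) ⟨x0, Nr.refl hδ' x0⟩
  refine ⟨O', h1, h2, fun x hx => hball x (Nr.mono hδδ.le (h3 hx)), Or.inr fun x hx hun => ?_⟩
  rcases h4 with h4 | h4
  · exact hnot O' h1 h2 h4
  · obtain ⟨r, s, hrs⟩ := hun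
    exact h4 hx ⟨r, s, hrs, fun i => (h3 hx i).le⟩

end NDSec

section FibSec

variable {L : FirstOrder.Language} {R : Type*} [L.Structure R] [AddCommGroup R] [LinearOrder R]
  [IsOrderedAddMonoid R] [DenselyOrdered R] [Nontrivial R] [TopologicalSpace R] [OrderTopology R]

theorem goodBox_of {n d : ℕ} {X : Set (Fin n → R)} {f : Fin d → Fin n} {y : Fin n → R} (hy : y ∈ X)
    {O : Set (Fin d → R)} (hO : IsOpen O) (hyO : y ∘ f ∈ O) {ε0 : R} (hε0 : 0 < ε0)
    (huniq : ∀ x x', x ∈ X → x' ∈ X → Nr ε0 y x → Nr ε0 y x' → x ∘ f = x' ∘ f → x ∘ f ∈ O → x = x')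
    (hcont : ∀ y1, y1 ∈ X → y1 ∘ f ∈ O → Nr ε0 y y1 → ∀ ε, 0 < ε → ∃ δ, 0 < δ ∧ ∀ z ∈ O,
      Nr δ (y1 ∘ f) z → ∃ x, x ∈ X ∧ x ∘ f = z ∧ Nr ε y1 x) :
    ∃ c e : Fin n → R, InBox c e y ∧ GoodBox f X c e := by
  classical
  obtain ⟨δ1, hδ1, h1⟩ := exists_nr hO hyO
  obtain ⟨δ2, hδ2, h2⟩ := hcont y hy hyO (Nr.refl hε0 y) ε0 hε0
  let δ := min ε0 (min δ1 δ2)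
  have hδ : 0 < δ := lt_min hε0 (lt_min hδ1 hδ2)
  have hδε : δ ≤ ε0 := min_le_left _ _
  have hδδ1 : δ ≤ δ1 := (min_le_right _ _).trans (min_le_left _ _)
  have hδδ2 : δ ≤ δ2 := (min_le_right _ _).trans (min_le_right _ _)
  let η : Fin n → R := fun i => if i ∈ range f then δ else ε0
  have hη : ∀ i, η i ≤ ε0 := fun i => by
    simp only [η]; split_ifs
    · exact hδε
    · exact le_rfl
  have hηf : ∀ k, η (f k) = δ := fun k => by simp [η]
  have hη0 : ∀ i, 0 < η i := fun i => by
    simp only [η]; split_ifs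
    · exact hδ
    · exact hε0
  have hbox : ∀ x, InBox (fun i => y i - η i) (fun i => y i + η i) x ↔ ∀ i, |x i - y i| < η i := by
    intro x
    unfold InBox
    refine forall_congr' fun i => ?_
    rw [abs_sub_lt_iff]
    constructor
    · exact fun h => ⟨sub_lt_iff_lt_add'.2 h.2, sub_lt_comm.1 h.1⟩
    · exact fun h => ⟨sub_lt_comm.1 h.2, sub_lt_iff_lt_add'.1 h.1⟩
  have hboxnr : ∀ x, InBox (fun i => y i - η i) (fun i => y i + η i) x → Nr ε0 y x := fun x hx i =>
    ((hbox x).1 hx i).trans_le (hη i)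
  have hboxO : ∀ x, InBox (fun i => y i - η i) (fun i => y i + η i) x → Nr δ (y ∘ f) (x ∘ f) :=
    fun x hx k => ((hbox x).1 hx (f k)).trans_eq (hηf k)
  refine ⟨fun i => y i - η i, fun i => y i + η i, (hbox y).2 fun i => by simpa using hη0 i,
    ?_, ?_, ?_⟩
  · intro y0 hy0
    have h3 := hboxO y0 hy0
    obtain ⟨x, hx, hxf, hxn⟩ := h2 (y0 ∘ f) (h1 _ (h3.mono hδδ1)) (h3.mono hδδ2)
    refine ⟨x, hx, (hbox x).2 fun i => ?_, fun j => congrFun hxf j⟩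
    by_cases hi : i ∈ range f
    · obtain ⟨k, rfl⟩ := hi
      have : x (f k) = y0 (f k) := congrFun hxf k
      rw [this]
      exact (hbox y0).1 hy0 (f k)
    · have : η i = ε0 := by simp only [η, hi, if_false]
      rw [this]; exact hxn i
  · intro x x' hx hxb hx' hxb' hxx i
    have := huniq x x' hx hx' (hboxnr x hxb) (hboxnr x' hxb') (funext hxx)
      (h1 _ ((hboxO x hxb).mono hδδ1))
    rw [this]
  · intro y2 hy2 hy2b p q hpq
    obtain ⟨ε2, hε2, h4⟩ := exists_nr ((isOpen_inBox p q).inter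
      (isOpen_inBox (fun i => y i - η i) (fun i => y i + η i))) ⟨hpq, hy2b⟩
    have hy2O := h1 _ ((hboxO y2 hy2b).mono hδδ1)
    obtain ⟨δ3, hδ3, h5⟩ := hcont y2 hy2 hy2O (hboxnr y2 hy2b) ε2 hε2
    refine ⟨fun j => y2 (f j) - δ3, fun j => y2 (f j) + δ3, fun j =>
      ⟨sub_lt_self _ hδ3, lt_add_of_pos_right _ hδ3⟩, fun y' hy' hy'b hy'n => ?_⟩
    have hy'O := h1 _ ((hboxO y' hy'b).mono hδδ1)
    obtain ⟨x, hx, hxf, hxn⟩ := h5 (y' ∘ f) hy'O (fun j => by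
      have := hy'n j
      rw [abs_sub_lt_iff]
      exact ⟨sub_lt_iff_lt_add'.2 this.2, sub_lt_comm.1 this.1⟩)
    have h6 := h4 x hxn
    have : x = y' := huniq x y' hx hy' (hboxnr x h6.2) (hboxnr y' hy'b) hxf (by rw [hxf]; exact hy'O)
    rw [← this]
    exact h6.1

/-- Coordinate projection of a family. -/
def PF {n : ℕ} {κ : Type} (g : κ → Fin n) (F : R → R → (Fin n → R) → Prop) (r s : R) (z : κ → R) :
    Prop := ∃ w, F r s w ∧ ∀ k, w (g k) = z k

theorem PF.ds [GS L R] {n : ℕ} {κ : Type} [Finite κ] (g : κ → Fin n)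
    {F : R → R → (Fin n → R) → Prop} (h : DS L F) : DS L (PF g F) := by
  refine DS.proj (L := L) (P := fun r s (z : κ → R) (w : Fin n → R) => F r s w ∧ ∀ k, w (g k) = z k) ?_
  refine ⟨?_, fun r s x hx => h.pos _ _ _ hx.1, fun r s => ?_, fun r s => ?_,
    fun r r' s x hr hx => ⟨h.mr _ _ _ _ hr hx.1, hx.2⟩,
    fun r s s' x h0 hr hx => ⟨h.ms _ _ _ _ h0 hr hx.1, hx.2⟩⟩
  · exact Dfn.and (DS.app h (DFn.var _) (DFn.var _) fun _ => DFn.var _)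
      (Dfn.finAll fun k => Dfn.eq (DFn.var _) (DFn.var _))
  · refine IsClosed.inter ((h.cl r s).preimage
      (f := fun (u : κ ⊕ Fin n → R) k => u (Sum.inr k)) (by fun_prop)) ?_
    have : {a : κ ⊕ Fin n → R | ∀ k, a (Sum.inr (g k)) = a (Sum.inl k)} =
      ⋂ k, {a | a (Sum.inr (g k)) = a (Sum.inl k)} := by ext; simp
    change IsClosed {a : κ ⊕ Fin n → R | ∀ k, a (Sum.inr (g k)) = a (Sum.inl k)}
    rw [this]
    exact isClosed_iInter fun k => isClosed_eq (by fun_prop) (by fun_prop)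
  · obtain ⟨c, e, hb⟩ := h.bd r s
    refine ⟨c, e, fun x hx i => ?_⟩
    rcases i with k | i
    · have hk : x (Sum.inr (g k)) = x (Sum.inl k) := hx.2 k
      rw [← hk]; exact hb _ hx.1 (g k)
    · exact hb _ hx.1 i

/-- The index map for an extra coordinate. -/
def oidx {n d : ℕ} (f : Fin d → Fin n) (j : Fin n) : Option (Fin d) → Fin n := fun o => o.elim j f

theorem avoid_WU [GS L R] {n d : ℕ} {F : R → R → (Fin n → R) → Prop} (h : DS L F)
    {f : Fin d → Fin n} (hf : Function.Injective f) {j : Fin n} (hj : j ∉ range f)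
    (hno : ∀ g : Fin (d + 1) → Fin n, Function.Injective g →
      ¬ (interior ((fun y => y ∘ g) '' {x | Un F x})).Nonempty)
    (p q : R) {O : Set (Fin d → R)} (hO : IsOpen O) (hne : O.Nonempty) :
    ¬ ∀ z ∈ O, Un (WU (PF (oidx f j) F) p q) z := by
  intro hsub
  have hP := PF.ds (oidx f j) h
  obtain ⟨O', r, s, h1, h2, -, h3⟩ := baire (WU.ds hP p q) hO hne hsub
  obtain ⟨O2, g1, ⟨x, hx⟩, g3⟩ := WU.interior hP h1 h2 h3
  have hinj : Function.Injective (oidx f j) := by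
    intro a b hab
    rcases a with _ | a <;> rcases b with _ | b
    · rfl
    · exact absurd ⟨b, hab.symm⟩ hj
    · exact absurd ⟨a, hab⟩ hj
    · exact congrArg some (hf hab)
  let e := finSuccEquiv d
  refine hno (oidx f j ∘ e) (hinj.comp e.injective) ⟨x ∘ e, ?_⟩
  refine mem_interior.2 ⟨(fun y : Fin (d + 1) → R => fun o => y (e.symm o)) ⁻¹' O2, fun y hy => ?_,
    g1.preimage (by fun_prop), ?_⟩
  · obtain ⟨w, hw, hwy⟩ := g3 _ hy
    refine ⟨w, ⟨r, s, hw⟩, ?_⟩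
    funext k
    have := hwy (e k)
    simpa using this
  · simpa using hx

theorem fibre_bound [GS L R] {n d : ℕ} {F : R → R → (Fin n → R) → Prop} (h : DS L F)
    (f : Fin d → Fin n) (x0 : Fin n → R) {δ1 : R} (hδ1 : 0 < δ1) :
    ∃ M : ℕ, ∃ δ : R, 0 < δ ∧ ∀ z, Nr δ (x0 ∘ f) z →
      (∀ j, j ∉ range f → ¬ Un (WU (PF (oidx f j) F) (x0 j - δ1) (x0 j + δ1)) z) →
      ∀ S : Finset (Fin n → R), (∀ x ∈ S, Un F x ∧ x ∘ f = z ∧ Nr δ x0 x) → S.card ≤ M := by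
  classical
  choose N δ hδ hN using fun j => fib_bound (PF.ds (oidx f j) h) (x0 j - δ1) (x0 j + δ1) (x0 j) (x0 ∘ f)
  obtain ⟨η, hη, hη1, hη2⟩ := exists_of_ev ((ev_le hδ1).and (Filter.eventually_all.2 fun j => ev_le (hδ j)))
  refine ⟨∏ j, (N j + 1), η, hη, fun z hz hnot S hS => ?_⟩
  have hsub : S ⊆ Fintype.piFinset (fun j => S.image (fun x => x j)) := by
    intro x hx
    rw [Fintype.mem_piFinset]
    exact fun j => Finset.mem_image_of_mem _ hx
  refine (Finset.card_le_card hsub).trans ?_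
  rw [Fintype.card_piFinset]
  refine Finset.prod_le_prod' fun j _ => ?_
  by_cases hj : j ∈ range f
  · obtain ⟨k, rfl⟩ := hj
    refine le_trans ?_ (Nat.le_add_left 1 _)
    refine Finset.card_le_one.2 fun a ha b hb => ?_
    obtain ⟨x, hx, rfl⟩ := Finset.mem_image.1 ha
    obtain ⟨x', hx', rfl⟩ := Finset.mem_image.1 hb
    exact (congrFun (hS x hx).2.1 k).trans (congrFun (hS x' hx').2.1 k).symm
  · refine le_trans (hN j z (hz.mono (hη2 j)) (hnot j hj) _ fun y hy => ?_) (Nat.le_succ _)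
    obtain ⟨x, hx, rfl⟩ := Finset.mem_image.1 hy
    obtain ⟨⟨r, s, hrs⟩, hxf, hxn⟩ := hS x hx
    have h4 := abs_sub_lt_iff.1 ((hxn j).trans_le hη1)
    refine ⟨⟨r, s, x, hrs, fun o => ?_⟩, (sub_lt_comm.1 h4.2).le, (sub_lt_iff_lt_add'.1 h4.1).le,
      (hxn j).trans_le (hη2 j)⟩
    rcases o with _ | k
    · rfl
    · exact congrFun hxf k

end FibSec

section TFSec

variable {L : FirstOrder.Language} {R : Type*} [L.Structure R] [AddCommGroup R] [LinearOrder R]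
  [IsOrderedAddMonoid R] [DenselyOrdered R] [Nontrivial R] [TopologicalSpace R] [OrderTopology R]

/-- The fibre over `z` contains `k + 1` points which are pairwise `s`-separated. -/
def TF {n d : ℕ} (f : Fin d → Fin n) (F : R → R → (Fin n → R) → Prop) (k : ℕ) (r s : R)
    (z : Fin d → R) : Prop :=
  ∃ w : Fin (k + 1) × Fin n → R, (∀ i, F r s (fun l => w (i, l))) ∧ (∀ i m, w (i, f m) = z m) ∧
    ∀ i i', i ≠ i' → ∃ l, s ≤ |w (i, l) - w (i', l)|

theorem TF.ds [GS L R] {n d : ℕ} (f : Fin d → Fin n) {F : R → R → (Fin n → R) → Prop} (h : DS L F)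
    (k : ℕ) : DS L (TF f F k) := by
  refine DS.proj (L := L) (P := fun r s (z : Fin d → R) (w : Fin (k + 1) × Fin n → R) =>
    (∀ i, F r s (fun l => w (i, l))) ∧ (∀ i m, w (i, f m) = z m) ∧
    ∀ i i', i ≠ i' → ∃ l, s ≤ |w (i, l) - w (i', l)|) ?_
  refine ⟨?_, fun r s x hx => h.pos _ _ _ (hx.1 0), fun r s => ?_, fun r s => ?_,
    fun r r' s x hr hx => ⟨fun i => h.mr _ _ _ _ hr (hx.1 i), hx.2⟩,
    fun r s s' x h0 hr hx => ⟨fun i => h.ms _ _ _ _ h0 hr (hx.1 i), hx.2.1, fun i i' hi => ?_⟩⟩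
  · refine Dfn.and (Dfn.finAll fun i => DS.app h (DFn.var _) (DFn.var _) fun _ => DFn.var _)
      (Dfn.and (Dfn.finAll fun i => Dfn.finAll fun m => Dfn.eq (DFn.var _) (DFn.var _))
      (Dfn.finAll fun i => Dfn.finAll fun i' => Dfn.imp Dfn.triv (Dfn.finEx fun l => ?_)))
    exact Dfn.leAbs (DFn.sub (DFn.var _) (DFn.var _)) (DFn.var _)
  · refine IsClosed.inter ?_ (IsClosed.inter ?_ ?_)
    · have : {a : Fin d ⊕ (Fin (k + 1) × Fin n) → R | ∀ i, F r s (fun l => a (Sum.inr (i, l)))} =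
        ⋂ i, {a | F r s (fun l => a (Sum.inr (i, l)))} := by ext; simp
      change IsClosed {a : Fin d ⊕ (Fin (k + 1) × Fin n) → R | ∀ i, F r s (fun l => a (Sum.inr (i, l)))}
      rw [this]
      exact isClosed_iInter fun i => (h.cl r s).preimage
        (f := fun (a : Fin d ⊕ (Fin (k + 1) × Fin n) → R) l => a (Sum.inr (i, l))) (by fun_prop)
    · have : {a : Fin d ⊕ (Fin (k + 1) × Fin n) → R | ∀ i m, a (Sum.inr (i, f m)) = a (Sum.inl m)} =
        ⋂ i, ⋂ m, {a | a (Sum.inr (i, f m)) = a (Sum.inl m)} := by ext; simp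
      change IsClosed {a : Fin d ⊕ (Fin (k + 1) × Fin n) → R | ∀ i m, a (Sum.inr (i, f m)) = a (Sum.inl m)}
      rw [this]
      exact isClosed_iInter fun i => isClosed_iInter fun m => isClosed_eq (by fun_prop) (by fun_prop)
    · have : {a : Fin d ⊕ (Fin (k + 1) × Fin n) → R | ∀ i i', i ≠ i' → ∃ l,
          s ≤ |a (Sum.inr (i, l)) - a (Sum.inr (i', l))|} =
        ⋂ i, ⋂ i', ⋂ (_ : i ≠ i'), ⋃ l, {a | s ≤ |a (Sum.inr (i, l)) - a (Sum.inr (i', l))|} := by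
          ext; simp
      change IsClosed {a : Fin d ⊕ (Fin (k + 1) × Fin n) → R | ∀ i i', i ≠ i' → ∃ l,
          s ≤ |a (Sum.inr (i, l)) - a (Sum.inr (i', l))|}
      rw [this]
      exact isClosed_iInter fun i => isClosed_iInter fun i' => isClosed_iInter fun _ =>
        isClosed_iUnion_of_finite fun l => isClosed_le (by fun_prop) (by fun_prop)
  · obtain ⟨c, e, hb⟩ := h.bd r s
    refine ⟨c, e, fun x hx i => ?_⟩
    rcases i with m | ⟨i, l⟩
    · have hk : x (Sum.inr (0, f m)) = x (Sum.inl m) := hx.2.1 0 m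
      rw [← hk]; exact hb _ (hx.1 0) (f m)
    · exact hb _ (hx.1 i) l
  · obtain ⟨l, hl⟩ := hx.2.2 i i' hi
    exact ⟨l, hr.trans hl⟩

theorem TF.of_inj {n d : ℕ} {f : Fin d → Fin n} {F : R → R → (Fin n → R) → Prop} (h : DS L F)
    {k : ℕ} {z : Fin d → R} (v : Fin (k + 1) → Fin n → R) (hinj : Function.Injective v)
    (hv : ∀ i, Un F (v i)) (hz : ∀ i, v i ∘ f = z) : Un (TF f F k) z := by
  choose r s hrs using hv
  obtain ⟨r0, hr0⟩ := Set.finite_range r |>.bddAbove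
  have hd : ∀ i i', i ≠ i' → ∃ l, 0 < |v i l - v i' l| := by
    intro i i' hi
    have : v i ≠ v i' := fun hh => hi (hinj hh)
    obtain ⟨l, hl⟩ := Function.ne_iff.1 this
    exact ⟨l, abs_pos.2 (sub_ne_zero.2 hl)⟩
  have e1 : ∀ᶠ t in 𝓝[>] (0 : R), ∀ i, t ≤ s i :=
    Filter.eventually_all.2 fun i => ev_le (h.pos _ _ _ (hrs i)).2
  have e2 : ∀ᶠ t in 𝓝[>] (0 : R), ∀ i i', i ≠ i' → ∃ l, t ≤ |v i l - v i' l| := by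
    refine Filter.eventually_all.2 fun i => Filter.eventually_all.2 fun i' => ?_
    by_cases hi : i = i'
    · exact Filter.Eventually.of_forall fun t h => absurd hi h
    · obtain ⟨l, hl⟩ := hd i i' hi
      exact (ev_le hl).mono fun t ht _ => ⟨l, ht⟩
  obtain ⟨t, ht, h1, h2⟩ := exists_of_ev (e1.and e2)
  refine ⟨r0, t, fun p => v p.1 p.2, fun i => ?_, fun i m => congrFun (hz i) m, h2⟩
  exact h.ms _ _ _ _ ht (h1 i) (h.mr _ _ _ _ (hr0 ⟨i, rfl⟩) (hrs i))

theorem TF.card {n d : ℕ} {f : Fin d → Fin n} {F : R → R → (Fin n → R) → Prop} (h : DS L F)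
    {k : ℕ} {z : Fin d → R} (hT : Un (TF f F k) z) :
    ∃ S : Finset (Fin n → R), S.card = k + 1 ∧ ∀ x ∈ S, Un F x ∧ x ∘ f = z := by
  classical
  obtain ⟨r, s, w, h1, h2, h3⟩ := hT
  have hs := (h.pos _ _ _ (h1 0)).2
  have hinj : Function.Injective (fun i l => w (i, l)) := by
    intro i i' hii
    by_contra hne
    obtain ⟨l, hl⟩ := h3 i i' hne
    have : w (i, l) = w (i', l) := congrFun hii l
    rw [this, sub_self, abs_zero] at hl
    exact absurd hl (not_le.2 hs)
  refine ⟨Finset.univ.image (fun i l => w (i, l)), ?_, ?_⟩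
  · rw [Finset.card_image_of_injective _ hinj]; simp
  · intro x hx
    obtain ⟨i, -, rfl⟩ := Finset.mem_image.1 hx
    exact ⟨⟨r, s, h1 i⟩, funext fun m => h2 i m⟩

theorem TF.eq_of_not {n d : ℕ} {f : Fin d → Fin n} {F : R → R → (Fin n → R) → Prop} (h : DS L F)
    {k : ℕ} {z : Fin d → R} {r s : R} (hs : 0 < s) (w : Fin (k + 1) × Fin n → R)
    (h1 : ∀ i, F r s (fun l => w (i, l))) (h2 : ∀ i m, w (i, f m) = z m)
    (h3 : ∀ i i', i ≠ i' → ∃ l, s ≤ |w (i, l) - w (i', l)|)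
    (hnot : ¬ Un (TF f F (k + 1)) z) {x : Fin n → R} (hx : Un F x) (hxz : x ∘ f = z) :
    ∃ i, x = fun l => w (i, l) := by
  by_contra hne
  push Not at hne
  refine hnot (TF.of_inj h (Fin.cons x (fun i l => w (i, l))) ?_ ?_ ?_)
  · rw [Fin.cons_injective_iff]
    refine ⟨?_, ?_⟩
    · rintro ⟨i, hi⟩
      exact hne i hi.symm
    · intro i i' hii
      by_contra hne
      obtain ⟨l, hl⟩ := h3 i i' hne
      have : w (i, l) = w (i', l) := congrFun hii l
      rw [this, sub_self, abs_zero] at hl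
      exact absurd hl (not_le.2 hs)
  · intro i
    refine Fin.cases ?_ (fun i => ?_) i
    · exact hx
    · exact ⟨r, s, h1 i⟩
  · intro i
    refine Fin.cases ?_ (fun i => ?_) i
    · exact hxz
    · exact funext fun m => h2 i m

theorem TF.cont [GS L R] {n d : ℕ} {f : Fin d → Fin n} {F : R → R → (Fin n → R) → Prop} (h : DS L F)
    {k : ℕ} {O : Set (Fin d → R)} {r s : R} (hT : ∀ z ∈ O, TF f F k r s z)
    (hnot : ∀ z ∈ O, ¬ Un (TF f F (k + 1)) z) {y : Fin n → R} (hy : Un F y) (hyO : y ∘ f ∈ O)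
    {ε : R} (hε : 0 < ε) :
    ∃ δ, 0 < δ ∧ ∀ z ∈ O, Nr δ (y ∘ f) z → ∃ x, Un F x ∧ x ∘ f = z ∧ Nr ε y x := by
  obtain ⟨w1, a1, a2, a3⟩ := hT _ hyO
  have hs := (h.pos _ _ _ (a1 0)).2
  obtain ⟨i0, hi0⟩ := TF.eq_of_not h hs w1 a1 a2 a3 (hnot _ hyO) hy rfl
  obtain ⟨t, ht, hts⟩ := exists_half hs
  let ε' := min ε t
  have hε' : 0 < ε' := lt_min hε ht
  have hε's : ε' + ε' < s := (add_le_add (min_le_right _ _) (min_le_right _ _)).trans_lt hts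
  obtain ⟨c, e, hb⟩ := h.bd r s
  have hcl : IsClosed {z : Fin d → R | ∃ x, F r s x ∧ (∀ i, ¬ Nr ε' (fun l => w1 (i, l)) x) ∧
      ∀ m, x (f m) = z m} := by
    refine proj_closed (L := L) (P := fun z x => F r s x ∧ (∀ i, ¬ Nr ε' (fun l => w1 (i, l)) x) ∧
      ∀ m, x (f m) = z m) (c := c) (e := e) ?_ ?_ (fun v w hw => hb w hw.1)
    · refine Dfn.and (DS.app h (DFn.const _) (DFn.const _) fun _ => DFn.var _)
        (Dfn.and (Dfn.finAll fun i => Dfn.not (Dfn.nr (DFn.const _) (fun _ => DFn.const _) (fun _ => DFn.var _)))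
        (Dfn.finAll fun m => Dfn.eq (DFn.var _) (DFn.var _)))
    · refine IsClosed.inter ((h.cl r s).preimage continuous_snd) (IsClosed.inter ?_ ?_)
      · have : {p : (Fin d → R) × (Fin n → R) | ∀ i, ¬ Nr ε' (fun l => w1 (i, l)) p.2} =
          ⋂ i, (Prod.snd ⁻¹' {x | Nr ε' (fun l => w1 (i, l)) x})ᶜ := by ext; simp
        change IsClosed {p : (Fin d → R) × (Fin n → R) | ∀ i, ¬ Nr ε' (fun l => w1 (i, l)) p.2}
        rw [this]
        exact isClosed_iInter fun i => ((isOpen_nr _ _).preimage continuous_snd).isClosed_compl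
      · have : {p : (Fin d → R) × (Fin n → R) | ∀ m, p.2 (f m) = p.1 m} =
          ⋂ m, {p | p.2 (f m) = p.1 m} := by ext; simp
        change IsClosed {p : (Fin d → R) × (Fin n → R) | ∀ m, p.2 (f m) = p.1 m}
        rw [this]
        exact isClosed_iInter fun m => isClosed_eq (by fun_prop) (by fun_prop)
  have hmem : y ∘ f ∈ {z : Fin d → R | ∃ x, F r s x ∧ (∀ i, ¬ Nr ε' (fun l => w1 (i, l)) x) ∧
      ∀ m, x (f m) = z m}ᶜ := by
    rintro ⟨x, b1, b2, b3⟩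
    obtain ⟨i, hi⟩ := TF.eq_of_not h hs w1 a1 a2 a3 (hnot _ hyO) ⟨r, s, b1⟩ (funext b3)
    exact b2 i (hi ▸ Nr.refl hε' _)
  obtain ⟨δ, hδ, hδn⟩ := exists_nr hcl.isOpen_compl hmem
  refine ⟨δ, hδ, fun z hz hzn => ?_⟩
  have hzc := hδn z hzn
  obtain ⟨w, c1, c2, c3⟩ := hT z hz
  have hφ : ∀ i, ∃ i', Nr ε' (fun l => w1 (i', l)) (fun l => w (i, l)) := by
    intro i
    by_contra hcon
    push Not at hcon
    exact hzc ⟨fun l => w (i, l), c1 i, hcon, c2 i⟩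
  choose φ hφ using hφ
  have hinj : Function.Injective φ := by
    intro i i' hii
    by_contra hne
    obtain ⟨l, hl⟩ := c3 i i' hne
    have g1 := (hφ i).symm
    have g2 := hφ i'
    rw [← hii] at g2
    have := (g1.trans g2) l
    rw [abs_sub_comm] at this
    exact absurd hl (not_le.2 (this.trans hε's))
  obtain ⟨i, hi⟩ := (Finite.injective_iff_surjective.1 hinj) i0
  refine ⟨fun l => w (i, l), ⟨r, s, c1 i⟩, funext fun m => c2 i m, ?_⟩
  have := hφ i
  rw [hi, ← hi0] at this
  exact this.mono (min_le_left _ _)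

end TFSec

section MainSec

variable {L : FirstOrder.Language} {R : Type*} [L.Structure R] [AddCommGroup R] [LinearOrder R]
  [IsOrderedAddMonoid R] [DenselyOrdered R] [Nontrivial R] [TopologicalSpace R] [OrderTopology R]

theorem avoid_all [GS L R] {n d : ℕ} (hc : ∀ (m : ℕ) (Y : Set (Fin m → R)), IsDSigma L Y →
    setDim Y < ((d : ℕ∞) : WithBot ℕ∞) → IsConstructibleSet Y)
    {F : R → R → (Fin n → R) → Prop} (h : DS L F)
    {f : Fin d → Fin n} (hf : Function.Injective f)
    (hno : ∀ g : Fin (d + 1) → Fin n, Function.Injective g →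
      ¬ (interior ((fun y => y ∘ g) '' {x | Un F x})).Nonempty)
    (p q : Fin n → R) {O : Set (Fin d → R)} (hO : IsOpen O) (hne : O.Nonempty) (J : Finset (Fin n)) :
    ∃ O1 : Set (Fin d → R), IsOpen O1 ∧ O1.Nonempty ∧ O1 ⊆ O ∧ ∀ j ∈ J, j ∉ range f → ∀ z ∈ O1,
      ¬ Un (WU (PF (oidx f j) F) (p j) (q j)) z := by
  classical
  induction J using Finset.induction_on with
  | empty => exact ⟨O, hO, hne, Subset.refl _, fun j hj => absurd hj (by simp)⟩
  | insert j J hj ih =>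
    obtain ⟨O1, h1, h2, h3, h4⟩ := ih
    by_cases hjf : j ∈ range f
    · refine ⟨O1, h1, h2, h3, fun j' hj' hj'f => ?_⟩
      rcases Finset.mem_insert.1 hj' with rfl | hj'
      · exact absurd hjf hj'f
      · exact h4 j' hj' hj'f
    · obtain ⟨O2, g1, g2, g3, g4⟩ := nd hc (WU.ds (PF.ds (oidx f j) h) (p j) (q j)) h1 h2
      rcases g4 with g4 | g4
      · exact absurd g4 (avoid_WU h hf hjf hno (p j) (q j) g1 g2)
      · refine ⟨O2, g1, g2, g3.trans h3, fun j' hj' hj'f z hz => ?_⟩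
        rcases Finset.mem_insert.1 hj' with rfl | hj'
        · exact g4 z hz
        · exact h4 j' hj' hj'f z (g3 hz)

theorem local_dim [GS L R] {n d : ℕ} {X : Set (Fin n → R)}
    (hdim : setDim X = ((d : ℕ∞) : WithBot ℕ∞)) (x0 : Fin n → R) :
    ∃ B : Set (Fin n → R), OpenBox B ∧ x0 ∈ B ∧ ∀ g : Fin (d + 1) → Fin n, Function.Injective g →
      ¬ (interior ((fun y => y ∘ g) '' (B ∩ X))).Nonempty := by
  by_contra hcon
  push Not at hcon
  have h1 : (((d + 1 : ℕ) : ℕ∞) : WithBot ℕ∞) ≤ locDim X x0 :=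
    le_sSup ⟨d + 1, rfl, fun B hB hx => hcon B hB hx⟩
  have h2 : locDim X x0 ≤ setDim X := le_iSup (fun x => locDim X x) x0
  have h3 := h1.trans (h2.trans_eq hdim)
  have : d + 1 ≤ d := by exact_mod_cast h3
  omega

/-- Maximal number of separated points in the fibres over an open set. -/
theorem exists_max_TF [GS L R] {n d : ℕ} (hc : ∀ (m : ℕ) (Y : Set (Fin m → R)), IsDSigma L Y →
    setDim Y < ((d : ℕ∞) : WithBot ℕ∞) → IsConstructibleSet Y)
    {F : R → R → (Fin n → R) → Prop} (h : DS L F) (f : Fin d → Fin n) {O : Set (Fin d → R)}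
    (hO : IsOpen O) (hne : O.Nonempty) (h0 : ∀ z ∈ O, Un (TF f F 0) z) {M : ℕ}
    (hM : ∀ k z, z ∈ O → Un (TF f F k) z → k ≤ M) :
    ∃ k r s, ∃ O' : Set (Fin d → R), IsOpen O' ∧ O'.Nonempty ∧ O' ⊆ O ∧
      (∀ z ∈ O', TF f F k r s z) ∧ ∀ z ∈ O', ¬ Un (TF f F (k + 1)) z := by
  have key : ∃ k, ∃ O' : Set (Fin d → R), IsOpen O' ∧ O'.Nonempty ∧ O' ⊆ O ∧
      (∀ z ∈ O', Un (TF f F k) z) ∧ ∀ z ∈ O', ¬ Un (TF f F (k + 1)) z := by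
    by_contra hcon
    push Not at hcon
    have : ∀ k, ∃ O' : Set (Fin d → R), IsOpen O' ∧ O'.Nonempty ∧ O' ⊆ O ∧
        (∀ z ∈ O', Un (TF f F k) z) := by
      intro k
      induction k with
      | zero => exact ⟨O, hO, hne, Subset.refl _, h0⟩
      | succ k ih =>
        obtain ⟨O1, h1, h2, h3, h4⟩ := ih
        obtain ⟨O2, g1, g2, g3, g4⟩ := nd hc (TF.ds f h (k + 1)) h1 h2
        rcases g4 with g4 | g4
        · exact ⟨O2, g1, g2, g3.trans h3, g4⟩
        · obtain ⟨z, hz, hzu⟩ := hcon k O2 g1 g2 (g3.trans h3) (fun z hz => h4 z (g3 hz))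
          exact absurd hzu (g4 z hz)
    obtain ⟨O1, h1, ⟨z, hz⟩, h3, h4⟩ := this (M + 1)
    have := hM (M + 1) z (h3 hz) (h4 z hz)
    omega
  obtain ⟨k, O1, h1, h2, h3, h4, h5⟩ := key
  obtain ⟨O2, r, s, g1, g2, g3, g4⟩ := baire (TF.ds f h k) h1 h2 h4
  exact ⟨k, r, s, O2, g1, g2, g3.trans h3, g4, fun z hz => h5 z (g3 hz)⟩

theorem main_dim [GS L R] {n d : ℕ} {X : Set (Fin n → R)}
    (hdim : setDim X = ((d : ℕ∞) : WithBot ℕ∞)) (hX : IsDSigma L X)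
    (hc : ∀ (m : ℕ) (Y : Set (Fin m → R)), IsDSigma L Y →
      setDim Y < ((d : ℕ∞) : WithBot ℕ∞) → IsConstructibleSet Y) :
    setDim (X \ goodPoints d X) < ((d : ℕ∞) : WithBot ℕ∞) := by
  obtain ⟨F, hF, hXF⟩ := DS.of_isDSigma hX
  refine setDim_lt fun x0 => ?_
  obtain ⟨B1, hB1, hx0B1, hno⟩ := local_dim (L := L) hdim x0
  have hB1o : IsOpen B1 := by
    obtain ⟨c, e, rfl⟩ := hB1
    exact isOpen_inBox c e
  obtain ⟨δ0, hδ0, hball⟩ := exists_nr hB1o hx0B1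
  obtain ⟨δ1, hδ1, hδ10⟩ := exists_between hδ0
  have hF1 := hF.ball x0 δ1
  have hno1 : ∀ g : Fin (d + 1) → Fin n, Function.Injective g →
      ¬ (interior ((fun y => y ∘ g) '' {x | Un (fun r s x => F r s x ∧ ∀ i, |x i - x0 i| ≤ δ1) x})).Nonempty := by
    intro g hg hne
    refine hno g hg (hne.mono (interior_mono (image_mono ?_)))
    rintro x ⟨r, s, h1, h2⟩
    exact ⟨hball x fun i => (h2 i).trans_lt hδ10, (hXF x).2 ⟨r, s, h1⟩⟩
  choose M δf hδf hM using fun f : Fin d → Fin n => fibre_bound hF1 f x0 hδ1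
  obtain ⟨δ3, hδ3, hδ31, hδ3f⟩ := exists_of_ev ((ev_le hδ1).and
    (Filter.eventually_all.2 fun f => ev_le (hδf f)))
  obtain ⟨δ', hδ', hδ'3⟩ := exists_between hδ3
  have hF' := hF.ball x0 δ'
  have hbox : ∀ x, InBox (fun i => x0 i - δ') (fun i => x0 i + δ') x ↔ Nr δ' x0 x := by
    intro x
    unfold InBox Nr
    refine forall_congr' fun i => ?_
    rw [abs_sub_lt_iff]
    constructor
    · exact fun h => ⟨sub_lt_iff_lt_add'.2 h.2, sub_lt_comm.1 h.1⟩
    · exact fun h => ⟨sub_lt_comm.1 h.2, sub_lt_iff_lt_add'.1 h.1⟩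
  refine ⟨{x | InBox (fun i => x0 i - δ') (fun i => x0 i + δ') x}, ⟨_, _, rfl⟩,
    (hbox x0).2 (Nr.refl hδ' x0), fun d' hd' f' hf' hint => ?_⟩
  have hint2 := interior_reduce hd' f' hint
  have hf : Function.Injective (f' ∘ Fin.castLE hd') := hf'.comp (Fin.castLE_injective hd')
  generalize f' ∘ Fin.castLE hd' = f at hint2 hf
  obtain ⟨O1, o1, o2, o3, o4⟩ := avoid_all hc hF1 hf hno1 (fun j => x0 j - δ1) (fun j => x0 j + δ1)
    isOpen_interior hint2 Finset.univ
  have hY : ∀ z ∈ O1, ∃ y, Nr δ' x0 y ∧ y ∈ X ∧ y ∉ goodPoints d X ∧ y ∘ f = z := by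
    intro z hz
    obtain ⟨y, hy, hyz⟩ := interior_subset (o3 hz)
    exact ⟨y, (hbox y).1 hy.1, hy.2.1, hy.2.2, hyz⟩
  have hX' : ∀ x, x ∈ X → Nr δ' x0 x → Un (fun r s x => F r s x ∧ ∀ i, |x i - x0 i| ≤ δ') x := by
    intro x hx hn
    obtain ⟨r, s, h⟩ := (hXF x).1 hx
    exact ⟨r, s, h, fun i => (hn i).le⟩
  have hX2 : ∀ x, Un (fun r s x => F r s x ∧ ∀ i, |x i - x0 i| ≤ δ') x → x ∈ X := by
    rintro x ⟨r, s, h, -⟩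
    exact (hXF x).2 ⟨r, s, h⟩
  obtain ⟨k, r, s, O2, p1, p2, p3, p4, p5⟩ := exists_max_TF (M := M f) hc hF' f o1 o2 (by
    intro z hz
    obtain ⟨y, y1, y2, y3, y4⟩ := hY z hz
    exact TF.of_inj hF' (fun _ => y) (fun a b _ => Subsingleton.elim (α := Fin 1) a b) (fun _ => hX' y y2 y1)
      (fun _ => y4)) (by
    intro k z hz hT
    obtain ⟨S, hS, hS2⟩ := TF.card hF' hT
    have hnr : ∀ x ∈ S, Nr (δf f) x0 x := by
      intro x hx
      obtain ⟨⟨r, s, h1, h2⟩, -⟩ := hS2 x hx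
      exact fun i => (h2 i).trans_lt (hδ'3.trans_le (hδ3f f))
    have hnz : Nr (δf f) (x0 ∘ f) z := by
      obtain ⟨x, hx⟩ := Finset.card_pos.1 (by omega : 0 < S.card)
      rw [← (hS2 x hx).2]
      exact fun m => hnr x hx (f m)
    have := hM f z hnz (fun j hj => o4 j (Finset.mem_univ _) hj z hz) S (fun x hx => by
      obtain ⟨⟨r, s, h1, h2⟩, h3⟩ := hS2 x hx
      exact ⟨⟨r, s, h1, fun i => (h2 i).trans (hδ'3.le.trans hδ31)⟩, h3, hnr x hx⟩)
    omega)
  obtain ⟨z0, hz0⟩ := p2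
  obtain ⟨y, y1, y2, y3, y4⟩ := hY z0 (p3 hz0)
  obtain ⟨w0, a1, -⟩ := p4 z0 hz0
  have hs : 0 < s := (hF'.pos _ _ _ (a1 0)).2
  obtain ⟨ε1, hε1, hε1n⟩ := exists_nr (isOpen_nr δ' x0) (x := y) y1
  obtain ⟨t, ht, hts⟩ := exists_half hs
  let ε0 := min ε1 t
  have hε0 : 0 < ε0 := lt_min hε1 ht
  have hε0s : ε0 + ε0 < s := (add_le_add (min_le_right _ _) (min_le_right _ _)).trans_lt hts
  have hin : ∀ x, Nr ε0 y x → Nr δ' x0 x := fun x hx => hε1n x (hx.mono (min_le_left _ _))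
  refine y3 ((mem_goodPoints_iff X y).2 ⟨y2, f, hf, goodBox_of y2 p1 (by rw [y4]; exact hz0) hε0 ?_ ?_⟩)
  · intro x x' hx hx' hn hn' hxx hxO
    obtain ⟨w, b1, b2, b3⟩ := p4 _ hxO
    obtain ⟨i, rfl⟩ := TF.eq_of_not hF' hs w b1 b2 b3 (p5 _ hxO) (hX' x hx (hin x hn)) rfl
    obtain ⟨i', rfl⟩ := TF.eq_of_not hF' hs w b1 b2 b3 (p5 _ hxO) (hX' x' hx' (hin x' hn')) hxx.symm
    by_cases hii : i = i'
    · rw [hii]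
    · obtain ⟨l, hl⟩ := b3 i i' hii
      have := (hn'.symm.trans hn) l
      exact absurd hl (not_le.2 (this.trans hε0s))
  · intro y' hy' hy'O hy'n ε hε
    obtain ⟨δ, hδ, hh⟩ := TF.cont hF' p4 p5 (hX' y' hy' (hin y' hy'n)) hy'O hε
    refine ⟨δ, hδ, fun z hz hzn => ?_⟩
    obtain ⟨x, hx, hx2⟩ := hh z hz hzn
    exact ⟨x, hX2 x hx, hx2⟩

end MainSec

end Helpers

/-- Let `𝓡` be a densely linearly ordered structure and let `X ⊆ R^n`
be a definable set of dimension `d < n`. Then `𝓖(X)` is definable and constructible.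
Furthermore, `dim(X \ 𝓖(X)) < d` provided that `𝓡` is a definably complete expansion of
a densely linearly ordered abelian group satisfying `LUF₂`, `X` is a `D_Σ`-set, and
every `D_Σ`-set of dimension smaller than `d` is constructible. -/
theorem goodPoints_constructible_and_bad_set_small_dim
    {R : Type*} (L : FirstOrder.Language) [L.Structure R]
    [LinearOrder R] [DenselyOrdered R] [TopologicalSpace R] [OrderTopology R]
    (hlt : IsDefinable L {v : Fin 2 → R | v 0 < v 1})
    {n d : ℕ} (hdn : d < n) (X : Set (Fin n → R)) (hXdef : IsDefinable L X)
    (hdim : setDim X = ((d : ℕ∞) : WithBot ℕ∞)) :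
    (IsDefinable L (goodPoints d X) ∧ IsConstructibleSet (goodPoints d X)) ∧
    (∀ [AddCommGroup R] [CovariantClass R R (· + ·) (· < ·)],
      IsDefinable L {v : Fin 3 → R | v 0 + v 1 = v 2} →
      DCProp L R → LUF2 L R → IsDSigma L X →
      (∀ (m : ℕ) (Y : Set (Fin m → R)), IsDSigma L Y →
        setDim Y < ((d : ℕ∞) : WithBot ℕ∞) → IsConstructibleSet Y) →
      setDim (X \ goodPoints d X) < ((d : ℕ∞) : WithBot ℕ∞)) := by
  haveI : DLt L R := ⟨hlt⟩
  haveI : NoMinOrder R := ⟨fun a => (exists_lt_gt_of_setDim hdn X hdim a).1⟩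
  haveI : NoMaxOrder R := ⟨fun a => (exists_lt_gt_of_setDim hdn X hdim a).2⟩
  refine ⟨⟨goodPoints_definable X hXdef, goodPoints_constructible X⟩, ?_⟩
  intro inst1 inst2 hadd hdc hluf hX hc
  haveI : IsOrderedAddMonoid R :=
    { add_le_add_left := fun a b hab c => by
        rcases hab.eq_or_lt with rfl | hlt'
        · exact le_rfl
        · rw [add_comm a c, add_comm b c]
          exact (CovariantClass.elim (μ := ((· + ·) : R → R → R)) (r := (· < ·)) c hlt').le }
  haveI : Nontrivial R := by
    obtain ⟨b, hb⟩ := exists_gt (0 : R)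
    exact ⟨⟨0, b, hb.ne⟩⟩
  haveI : GS L R := { lt_def := hlt, add_def := hadd, dc := hdc, luf := hluf }
  exact main_dim hdim hX hc
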